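/- arXiv:0909.5088 — 4 statements merged into one kernel-verified Lean document; each statement's English description precedes it below -/
import Mathlib

section
/- Let F be a finite field with q elements and n ≥ 0. Let Y_n = {(A,B,C,v) ∈ M_n(F)³ × Fⁿ : trace(A(BC−CB)) = 0} and Z_n = {(A,B,C,v) ∈ M_n(F)³ × Fⁿ : trace(A(BC−CB)) = 1}, and let c_n be the number of pairs (B,C) ∈ M_n(F)² with BC = CB. Then #Y_n − #Z_n = q^{n(n+1)} · c_n. -/
open Matrix

/-- The zero fibre and the unit fibre of a linear functional on a finite space have the same
size unless the functional vanishes. -/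
theorem card_fiber_zero_sub_card_fiber_one {F V : Type*} [Field F] [AddCommGroup V] [Module F V]
    [Finite V] (f : V →ₗ[F] F) [Decidable (f = 0)] :
    (Nat.card {x // f x = 0} : ℤ) - Nat.card {x // f x = 1} =
      if f = 0 then (Nat.card V : ℤ) else 0 := by
  split_ifs with hf
  · subst hf
    simp
  · obtain ⟨y, hy⟩ := LinearMap.surjective hf 1
    rw [Nat.card_congr ((Equiv.addRight y).subtypeEquiv (p := fun x => f x = 0)
      (q := fun x => f x = 1) fun x => by simp [hy]), sub_self]

/-- A set of pairs is counted by summing over the second coordinate. -/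
theorem Nat.card_subtype_prod_eq_sum {α β : Type*} [Finite α] [Fintype β] (P : α × β → Prop) :
    Nat.card {p // P p} = ∑ b, Nat.card {a // P (a, b)} := by
  rw [← Nat.card_sigma]
  exact Nat.card_congr
    { toFun := fun p => ⟨p.1.2, p.1.1, p.2⟩
      invFun := fun s => ⟨(s.2.1, s.1), s.2.2⟩
      left_inv := fun _ => rfl
      right_inv := fun _ => rfl }

/-- The trace pairing against a fixed matrix, as a linear functional. -/
def Matrix.traceMulRight {m F : Type*} [Fintype m] [CommRing F] (M : Matrix m m F) :
    Matrix m m F →ₗ[F] F :=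
  Matrix.traceLinearMap m F F ∘ₗ LinearMap.mulRight F M

theorem Matrix.traceMulRight_apply {m F : Type*} [Fintype m] [CommRing F] (M A : Matrix m m F) :
    M.traceMulRight A = trace (A * M) := rfl

theorem Matrix.traceMulRight_eq_zero_iff {m F : Type*} [Fintype m] [CommRing F]
    (M : Matrix m m F) : M.traceMulRight = 0 ↔ M = 0 := by
  rw [LinearMap.ext_iff, Matrix.ext_iff_trace_mul_left]
  simp [Matrix.traceMulRight_apply]

/-- Over a finite field `F` with `q` elements,
`#Y_n − #Z_n = q^{n(n+1)} · c_n`, where `Y_n` (resp. `Z_n`) is the set of tuples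
`(A,B,C,v) ∈ M_n(F)³ × Fⁿ` with `trace(A(BC−CB)) = 0` (resp. `= 1`), and `c_n` is the
number of commuting pairs of `n×n` matrices. -/
theorem statement_1 (F : Type*) [Field F] [Fintype F] (q : ℕ) (hq : Fintype.card F = q)
    (n : ℕ) :
    (Nat.card {p : Matrix (Fin n) (Fin n) F × Matrix (Fin n) (Fin n) F ×
        Matrix (Fin n) (Fin n) F × (Fin n → F) //
        Matrix.trace (p.1 * (p.2.1 * p.2.2.1 - p.2.2.1 * p.2.1)) = 0} : ℤ) -
      (Nat.card {p : Matrix (Fin n) (Fin n) F × Matrix (Fin n) (Fin n) F ×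
        Matrix (Fin n) (Fin n) F × (Fin n → F) //
        Matrix.trace (p.1 * (p.2.1 * p.2.2.1 - p.2.2.1 * p.2.1)) = 1} : ℤ) =
    (q : ℤ) ^ (n * (n + 1)) *
      (Nat.card {p : Matrix (Fin n) (Fin n) F × Matrix (Fin n) (Fin n) F //
        p.1 * p.2 = p.2 * p.1} : ℤ) := by
  classical
  rw [Nat.card_subtype_prod_eq_sum, Nat.card_subtype_prod_eq_sum, Nat.cast_sum, Nat.cast_sum,
    ← Finset.sum_sub_distrib]
  simp only [← Matrix.traceMulRight_apply, card_fiber_zero_sub_card_fiber_one,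
    Matrix.traceMulRight_eq_zero_iff, sub_eq_zero]
  have hM : (Nat.card (Matrix (Fin n) (Fin n) F) : ℤ) = q ^ (n * n) := by
    simp [Matrix, hq, pow_mul]
  rw [hM, Nat.card_eq_fintype_card, Fintype.card_subtype, Finset.natCast_card_filter,
    Finset.mul_sum, Fintype.sum_prod_type, Fintype.sum_prod_type]
  refine Finset.sum_congr rfl fun B _ => ?_
  rw [Fintype.sum_prod_type]
  refine Finset.sum_congr rfl fun C _ => ?_
  by_cases h : B * C = C * B
  · simp [h, hq]
    ring
  · simp [h]
end

section
/- Let F be a finite field with q elements and let 0 ≤ k ≤ n. Then w_n^k = G_q(k,n) · q^{(n−k)(n+2k)} · c_{n−k} · w_k^k, where w_m^j = #Y_m^j − #Z_m^j, G_q(k,n) is the number of k-dimensional F-subspaces of Fⁿ, and c_m is the number of pairs (B,C) ∈ M_m(F)² with BC = CB. -/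
open Matrix

variable (F : Type*) [Field F] [Fintype F]

/-- The `(A,B,C)`-span of `v`: the smallest subspace of `Fⁿ` containing `v` and
invariant under `A`, `B` and `C`. -/
def abcSpan {n : ℕ} (A B C : Matrix (Fin n) (Fin n) F) (v : Fin n → F) :
    Submodule F (Fin n → F) :=
  sInf {W | v ∈ W ∧ (∀ w ∈ W, A.mulVec w ∈ W) ∧ (∀ w ∈ W, B.mulVec w ∈ W) ∧
    (∀ w ∈ W, C.mulVec w ∈ W)}

/-- `#Y_n^k`: the number of tuples `(A,B,C,v) ∈ M_n(F)³ × Fⁿ` with `tr(A(BC−CB)) = 0`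
whose `(A,B,C)`-span of `v` has dimension `k`. -/
noncomputable def Ycard (n k : ℕ) : ℕ :=
  Nat.card {p : Matrix (Fin n) (Fin n) F × Matrix (Fin n) (Fin n) F ×
    Matrix (Fin n) (Fin n) F × (Fin n → F) //
    Matrix.trace (p.1 * (p.2.1 * p.2.2.1 - p.2.2.1 * p.2.1)) = 0 ∧
    Module.finrank F (abcSpan F p.1 p.2.1 p.2.2.1 p.2.2.2) = k}

/-- `#Z_n^k`: the number of tuples `(A,B,C,v) ∈ M_n(F)³ × Fⁿ` with `tr(A(BC−CB)) = 1`
whose `(A,B,C)`-span of `v` has dimension `k`. -/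
noncomputable def Zcard (n k : ℕ) : ℕ :=
  Nat.card {p : Matrix (Fin n) (Fin n) F × Matrix (Fin n) (Fin n) F ×
    Matrix (Fin n) (Fin n) F × (Fin n → F) //
    Matrix.trace (p.1 * (p.2.1 * p.2.2.1 - p.2.2.1 * p.2.1)) = 1 ∧
    Module.finrank F (abcSpan F p.1 p.2.1 p.2.2.1 p.2.2.2) = k}

/-- `w_n^k = #Y_n^k − #Z_n^k`. -/
noncomputable def w (n k : ℕ) : ℤ := (Ycard F n k : ℤ) - (Zcard F n k : ℤ)

/-- `c_m`: the number of commuting pairs of `m×m` matrices over `F`. -/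
noncomputable def ccount (m : ℕ) : ℕ :=
  Nat.card {p : Matrix (Fin m) (Fin m) F × Matrix (Fin m) (Fin m) F //
    p.1 * p.2 = p.2 * p.1}

/-- `G_q(k,n)`: the number of `k`-dimensional subspaces of `Fⁿ`. -/
noncomputable def grassCard (k n : ℕ) : ℕ :=
  Nat.card {W : Submodule F (Fin n → F) // Module.finrank F W = k}

section Spans

variable {K ι κ : Type*} [Field K]

/-- Extension by zero, `K^ι → K^(ι ⊕ κ)`. -/
def extendZero : (ι → K) →ₗ[K] (ι ⊕ κ → K) where
  toFun v := Sum.elim v 0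
  map_add' v w := by ext (i | i) <;> simp
  map_smul' c v := by ext (i | i) <;> simp

theorem extendZero_injective :
    Function.Injective (extendZero : (ι → K) →ₗ[K] (ι ⊕ κ → K)) := fun _ _ h =>
  funext fun i => congrFun h (Sum.inl i)

variable [Fintype ι] [Fintype κ]

/-- The smallest subspace of `K^ι` containing `v` and invariant under `A`, `B` and `C`. -/
def orbitSpan (A B C : Matrix ι ι K) (v : ι → K) : Submodule K (ι → K) :=
  sInf {W | v ∈ W ∧ (∀ w ∈ W, A.mulVec w ∈ W) ∧ (∀ w ∈ W, B.mulVec w ∈ W) ∧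
    (∀ w ∈ W, C.mulVec w ∈ W)}

theorem orbitSpan_le {A B C : Matrix ι ι K} {v : ι → K} {W : Submodule K (ι → K)}
    (hv : v ∈ W) (hA : ∀ w ∈ W, A *ᵥ w ∈ W) (hB : ∀ w ∈ W, B *ᵥ w ∈ W)
    (hC : ∀ w ∈ W, C *ᵥ w ∈ W) : orbitSpan A B C v ≤ W :=
  sInf_le ⟨hv, hA, hB, hC⟩

theorem mem_orbitSpan (A B C : Matrix ι ι K) (v : ι → K) : v ∈ orbitSpan A B C v :=
  Submodule.mem_sInf.2 fun _ hW => hW.1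

theorem orbitSpan_invariant (A B C : Matrix ι ι K) (v : ι → K) :
    (∀ w ∈ orbitSpan A B C v, A *ᵥ w ∈ orbitSpan A B C v) ∧
    (∀ w ∈ orbitSpan A B C v, B *ᵥ w ∈ orbitSpan A B C v) ∧
    (∀ w ∈ orbitSpan A B C v, C *ᵥ w ∈ orbitSpan A B C v) := by
  refine ⟨fun w hw => ?_, fun w hw => ?_, fun w hw => ?_⟩ <;>
    refine Submodule.mem_sInf.2 fun W hW => ?_
  · exact hW.2.1 w (Submodule.mem_sInf.1 hw W hW)
  · exact hW.2.2.1 w (Submodule.mem_sInf.1 hw W hW)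
  · exact hW.2.2.2 w (Submodule.mem_sInf.1 hw W hW)

/-- An intertwining linear map carries the span of `v` onto the span of its image. -/
theorem orbitSpan_map (f : (ι → K) →ₗ[K] (κ → K)) {A B C : Matrix ι ι K}
    {A' B' C' : Matrix κ κ K} (v : ι → K) (hA : ∀ x, f (A *ᵥ x) = A' *ᵥ f x)
    (hB : ∀ x, f (B *ᵥ x) = B' *ᵥ f x) (hC : ∀ x, f (C *ᵥ x) = C' *ᵥ f x) :
    orbitSpan A' B' C' (f v) = (orbitSpan A B C v).map f := by
  obtain ⟨iA, iB, iC⟩ := orbitSpan_invariant A B C v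
  obtain ⟨jA, jB, jC⟩ := orbitSpan_invariant A' B' C' (f v)
  apply le_antisymm
  · refine orbitSpan_le (Submodule.mem_map_of_mem (mem_orbitSpan A B C v)) ?_ ?_ ?_ <;>
      rintro _ ⟨x, hx, rfl⟩
    · exact hA x ▸ Submodule.mem_map_of_mem (iA x hx)
    · exact hB x ▸ Submodule.mem_map_of_mem (iB x hx)
    · exact hC x ▸ Submodule.mem_map_of_mem (iC x hx)
  · refine Submodule.map_le_iff_le_comap.2 (orbitSpan_le (mem_orbitSpan A' B' C' (f v)) ?_ ?_ ?_) <;>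
      intro x hx <;> rw [Submodule.mem_comap] at hx ⊢
    · exact hA x ▸ jA _ hx
    · exact hB x ▸ jB _ hx
    · exact hC x ▸ jC _ hx

open Classical in
/-- The indicator of `0` minus the indicator of `1`. -/
noncomputable def zeroSubOne (x : K) : ℤ :=
  (if x = 0 then 1 else 0) - (if x = 1 then 1 else 0)

/-- The trace potential `tr (A (BC - CB))`. -/
def potential (A B C : Matrix ι ι K) : K := trace (A * (B * C - C * B))

/-- The signed number of tuples `(A, B, C, v)` whose span is `W`. -/
noncomputable def signedCount [Fintype K] [DecidableEq ι] (W : Submodule K (ι → K)) : ℤ :=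
  ∑ p : Matrix ι ι K × Matrix ι ι K × Matrix ι ι K × (ι → K),
    if orbitSpan p.1 p.2.1 p.2.2.1 p.2.2.2 = W then
      zeroSubOne (potential p.1 p.2.1 p.2.2.1) else 0

theorem signedCount_map [Fintype K] [DecidableEq ι] [DecidableEq κ] (f : (ι → K) ≃ₗ[K] (κ → K))
    (W : Submodule K (ι → K)) :
    signedCount (W.map (f : (ι → K) →ₗ[K] (κ → K))) = signedCount W := by
  let φ : Matrix ι ι K ≃ₐ[K] Matrix κ κ K :=
    (Matrix.toLinAlgEquiv'.trans (f.conjAlgEquiv K)).trans LinearMap.toMatrixAlgEquiv'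
  have hφ (A : Matrix ι ι K) (x : ι → K) : f (A *ᵥ x) = φ A *ᵥ f x := by
    have : Matrix.toLinAlgEquiv' (φ A) = f.conjAlgEquiv K (Matrix.toLinAlgEquiv' A) := by
      simp [φ]
    rw [← Matrix.toLinAlgEquiv'_apply (φ A), this]
    simp
  have htr (A : Matrix ι ι K) : trace (φ A) = trace A := by
    rw [← Matrix.trace_toLin'_eq A, ← LinearMap.trace_conj' _ f, ← Matrix.trace_toLin'_eq (φ A)]
    congr 1
    exact Matrix.toLinAlgEquiv'_toMatrixAlgEquiv' (f.conjAlgEquiv K (Matrix.toLinAlgEquiv' A))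
  symm
  refine Fintype.sum_equiv (φ.toEquiv.prodCongr
    (φ.toEquiv.prodCongr (φ.toEquiv.prodCongr f.toEquiv))) _ _ ?_
  rintro ⟨A, B, C, v⟩
  have h1 := orbitSpan_map (f : (ι → K) →ₗ[K] (κ → K)) v (hφ A) (hφ B) (hφ C)
  have h2 : potential (φ A) (φ B) (φ C) = potential A B C := by
    rw [potential, ← map_mul, ← map_mul, ← map_sub, ← map_mul, htr, potential]
  have h3 : orbitSpan (φ A) (φ B) (φ C) (f v) = W.map (f : (ι → K) →ₗ[K] (κ → K)) ↔
      orbitSpan A B C v = W := by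
    rw [show f v = (f : (ι → K) →ₗ[K] (κ → K)) v from rfl, h1]
    exact (Submodule.map_injective_of_injective f.injective).eq_iff
  change _ = if orbitSpan (φ A) (φ B) (φ C) (f v) = _ then
    zeroSubOne (potential (φ A) (φ B) (φ C)) else 0
  simp only [h2, h3]

theorem sum_zeroSubOne_add_eq_zero {G : Type*} [Fintype G] [AddCommGroup G] (L : G →+ K)
    (hL : ∃ g, L g = 1) (t : K) : ∑ g, zeroSubOne (t + L g) = 0 := by
  classical
  obtain ⟨g₀, hg₀⟩ := hL
  simp only [zeroSubOne, Finset.sum_sub_distrib]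
  rw [sub_eq_zero]
  refine Fintype.sum_equiv (Equiv.addRight g₀) _ _ fun g => ?_
  simp only [Equiv.coe_addRight, map_add, hg₀, ← add_assoc, add_eq_right]

theorem exists_trace_mul_eq_one {D : Matrix ι ι K} (hD : D ≠ 0) :
    ∃ A : Matrix ι ι K, trace (A * D) = 1 := by
  have : ∃ A : Matrix ι ι K, trace (A * D) ≠ 0 := by
    by_contra! h
    exact hD (Matrix.ext_iff_trace_mul_left.2 fun A => by simpa using h A)
  obtain ⟨A, hA⟩ := this
  exact ⟨(trace (A * D))⁻¹ • A, by simp [hA]⟩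

theorem card_matrix_eq {R : Type*} [Fintype R] [DecidableEq ι] [DecidableEq κ] :
    Fintype.card (Matrix ι κ R) = Fintype.card R ^ (Fintype.card ι * Fintype.card κ) := by
  rw [Fintype.card_congr Matrix.of.symm, Fintype.card_fun, Fintype.card_fun, ← pow_mul, mul_comm]

/-- Adding an independent potential rescales the signed count by the number of commuting pairs. -/
theorem sum_zeroSubOne_add_potential [Fintype K] [DecidableEq ι] (t : K) :
    ∑ p : Matrix ι ι K × Matrix ι ι K × Matrix ι ι K,
      zeroSubOne (t + potential p.1 p.2.1 p.2.2) =
    (Fintype.card K : ℤ) ^ (Fintype.card ι * Fintype.card ι) *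
      (Nat.card {p : Matrix ι ι K × Matrix ι ι K // p.1 * p.2 = p.2 * p.1} : ℤ) *
      zeroSubOne t := by
  classical
  rw [Fintype.sum_prod_type_right]
  have key (p : Matrix ι ι K × Matrix ι ι K) :
      ∑ A : Matrix ι ι K, zeroSubOne (t + potential A p.1 p.2) =
      if p.1 * p.2 = p.2 * p.1 then
        (Fintype.card K : ℤ) ^ (Fintype.card ι * Fintype.card ι) * zeroSubOne t else 0 := by
    split_ifs with h
    · simp [potential, h, card_matrix_eq]
    · exact sum_zeroSubOne_add_eq_zero
        (AddMonoidHom.mk' (fun A : Matrix ι ι K => potential A p.1 p.2) fun A A' => by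
          simp [potential, add_mul])
        (exists_trace_mul_eq_one (sub_ne_zero.2 h)) t
  simp only [key]
  rw [← Finset.sum_filter, Finset.sum_const, Nat.card_eq_fintype_card, Fintype.card_subtype,
    nsmul_eq_mul]
  ring

theorem orbitSpan_fromBlocks (A₁ B₁ C₁ : Matrix ι ι K) (A₂ B₂ C₂ : Matrix ι κ K)
    (A₃ B₃ C₃ : Matrix κ κ K) (v : ι → K) :
    orbitSpan (fromBlocks A₁ A₂ 0 A₃) (fromBlocks B₁ B₂ 0 B₃) (fromBlocks C₁ C₂ 0 C₃)
      (extendZero v) = LinearMap.range (extendZero : (ι → K) →ₗ[K] (ι ⊕ κ → K)) ↔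
    orbitSpan A₁ B₁ C₁ v = ⊤ := by
  have h (A₁ : Matrix ι ι K) (A₂ : Matrix ι κ K) (A₃ : Matrix κ κ K) (x : ι → K) :
      (extendZero (A₁ *ᵥ x) : ι ⊕ κ → K) = fromBlocks A₁ A₂ 0 A₃ *ᵥ extendZero x := by
    simp [extendZero, fromBlocks_mulVec]
  rw [orbitSpan_map extendZero v (h A₁ A₂ A₃) (h B₁ B₂ B₃) (h C₁ C₂ C₃), ← Submodule.map_top]
  exact (Submodule.map_injective_of_injective extendZero_injective).eq_iff

theorem potential_fromBlocks (A₁ B₁ C₁ : Matrix ι ι K) (A₂ B₂ C₂ : Matrix ι κ K)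
    (A₃ B₃ C₃ : Matrix κ κ K) :
    potential (fromBlocks A₁ A₂ 0 A₃) (fromBlocks B₁ B₂ 0 B₃) (fromBlocks C₁ C₂ 0 C₃) =
      potential A₁ B₁ C₁ + potential A₃ B₃ C₃ := by
  simp [potential, fromBlocks_multiply, sub_eq_add_neg, fromBlocks_neg, fromBlocks_add,
    trace, Fintype.sum_sum_type]

theorem toBlocks₂₁_eq_zero {A : Matrix (ι ⊕ κ) (ι ⊕ κ) K}
    (hA : ∀ w ∈ LinearMap.range (extendZero : (ι → K) →ₗ[K] (ι ⊕ κ → K)),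
      A *ᵥ w ∈ LinearMap.range (extendZero : (ι → K) →ₗ[K] (ι ⊕ κ → K))) :
    A.toBlocks₂₁ = 0 := by
  classical
  ext j i
  obtain ⟨y, hy⟩ := hA (extendZero (Pi.single i 1)) ⟨_, rfl⟩
  have h : (extendZero (Pi.single i 1) : ι ⊕ κ → K) = Pi.single (Sum.inl i) 1 := by
    ext (a | a) <;> simp [extendZero, Pi.single_apply]
  have := congrFun hy (Sum.inr j)
  rw [h, Matrix.mulVec_single_one] at this
  simpa [extendZero, toBlocks₂₁] using this.symm

theorem signedCount_range_extendZero [Fintype K] [DecidableEq ι] [DecidableEq κ] :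
    signedCount (LinearMap.range (extendZero : (ι → K) →ₗ[K] (ι ⊕ κ → K))) =
    (Fintype.card K : ℤ) ^
        (3 * (Fintype.card ι * Fintype.card κ) + Fintype.card κ * Fintype.card κ) *
      (Nat.card {p : Matrix κ κ K × Matrix κ κ K // p.1 * p.2 = p.2 * p.1} : ℤ) *
      signedCount (⊤ : Submodule K (ι → K)) := by
  let e : ((Matrix ι ι K × Matrix ι ι K × Matrix ι ι K × (ι → K)) ×
      (Matrix ι κ K × Matrix ι κ K × Matrix ι κ K)) ×
      (Matrix κ κ K × Matrix κ κ K × Matrix κ κ K) →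
      Matrix (ι ⊕ κ) (ι ⊕ κ) K × Matrix (ι ⊕ κ) (ι ⊕ κ) K × Matrix (ι ⊕ κ) (ι ⊕ κ) K ×
        (ι ⊕ κ → K) := fun x =>
    (fromBlocks x.1.1.1 x.1.2.1 0 x.2.1, fromBlocks x.1.1.2.1 x.1.2.2.1 0 x.2.2.1,
      fromBlocks x.1.1.2.2.1 x.1.2.2.2 0 x.2.2.2, extendZero x.1.1.2.2.2)
  have he : Function.Injective e := by
    rintro ⟨⟨⟨A₁, B₁, C₁, v⟩, A₂, B₂, C₂⟩, A₃, B₃, C₃⟩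
      ⟨⟨⟨A₁', B₁', C₁', v'⟩, A₂', B₂', C₂'⟩, A₃', B₃', C₃'⟩ h
    simp only [e, Prod.mk.injEq, fromBlocks_inj, extendZero_injective.eq_iff] at h ⊢
    tauto
  have hsum : signedCount (LinearMap.range (extendZero : (ι → K) →ₗ[K] (ι ⊕ κ → K))) =
      ∑ x : ((Matrix ι ι K × Matrix ι ι K × Matrix ι ι K × (ι → K)) ×
      (Matrix ι κ K × Matrix ι κ K × Matrix ι κ K)) ×
      (Matrix κ κ K × Matrix κ κ K × Matrix κ κ K),
      if orbitSpan x.1.1.1 x.1.1.2.1 x.1.1.2.2.1 x.1.1.2.2.2 = ⊤ then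
        zeroSubOne (potential x.1.1.1 x.1.1.2.1 x.1.1.2.2.1 +
          potential x.2.1 x.2.2.1 x.2.2.2) else 0 := by
    symm
    refine Finset.sum_of_injOn e he.injOn (by simp) ?_ ?_
    · rintro ⟨A, B, C, v⟩ - hp
      refine if_neg fun hW => hp ?_
      dsimp only at hW
      obtain ⟨hA, hB, hC⟩ := orbitSpan_invariant A B C v
      have hv := mem_orbitSpan A B C v
      rw [hW] at hA hB hC hv
      obtain ⟨v, rfl⟩ := hv
      refine ⟨(((A.toBlocks₁₁, B.toBlocks₁₁, C.toBlocks₁₁, v),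
        A.toBlocks₁₂, B.toBlocks₁₂, C.toBlocks₁₂),
        A.toBlocks₂₂, B.toBlocks₂₂, C.toBlocks₂₂), by simp, ?_⟩
      simp only [e]
      rw [← toBlocks₂₁_eq_zero hA, fromBlocks_toBlocks, toBlocks₂₁_eq_zero hA,
        ← toBlocks₂₁_eq_zero hB, fromBlocks_toBlocks, toBlocks₂₁_eq_zero hB,
        ← toBlocks₂₁_eq_zero hC, fromBlocks_toBlocks]
    · rintro x -
      simp only [e, orbitSpan_fromBlocks, potential_fromBlocks]
  rw [hsum, Fintype.sum_prod_type, Fintype.sum_prod_type, signedCount, Finset.mul_sum]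
  refine Finset.sum_congr rfl fun p _ => ?_
  split_ifs with hp
  · simp only [sum_zeroSubOne_add_potential, Finset.sum_const, Finset.card_univ,
      Fintype.card_prod, card_matrix_eq, nsmul_eq_mul]
    push_cast
    ring
  · simp

/-- The standard coordinate subspace can be carried onto any subspace of the same dimension. -/
theorem exists_linearEquiv_map_range_extendZero {k m : ℕ}
    (hm : k + m = Fintype.card ι) {W : Submodule K (ι → K)} (hW : Module.finrank K W = k) :
    ∃ f : (Fin k ⊕ Fin m → K) ≃ₗ[K] (ι → K),
      (LinearMap.range (extendZero : (Fin k → K) →ₗ[K] (Fin k ⊕ Fin m → K))).map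
        (f : (Fin k ⊕ Fin m → K) →ₗ[K] (ι → K)) = W := by
  obtain ⟨W', hW'⟩ := Submodule.exists_isCompl W
  have hadd := Submodule.finrank_add_eq_of_isCompl hW'
  rw [Module.finrank_fintype_fun_eq_card] at hadd
  let e₁ : (Fin k → K) ≃ₗ[K] W := LinearEquiv.ofFinrankEq _ _ (by simp [hW])
  let e₂ : (Fin m → K) ≃ₗ[K] W' := LinearEquiv.ofFinrankEq _ _ (by simp; omega)
  let f : (Fin k ⊕ Fin m → K) ≃ₗ[K] (ι → K) :=
    (LinearEquiv.sumArrowLequivProdArrow (Fin k) (Fin m) K K).trans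
      ((e₁.prodCongr e₂).trans (Submodule.prodEquivOfIsCompl W W' hW'))
  refine ⟨f, ?_⟩
  have hf : (f : (Fin k ⊕ Fin m → K) →ₗ[K] (ι → K)) ∘ₗ extendZero =
      W.subtype ∘ₗ (e₁ : (Fin k → K) →ₗ[K] W) := by
    refine LinearMap.ext fun x => ?_
    have h0 : (LinearEquiv.sumArrowLequivProdArrow (Fin k) (Fin m) K K) (extendZero x) = (x, 0) :=
      Prod.ext rfl rfl
    simp [f, h0]
  rw [← LinearMap.range_comp, hf, LinearMap.range_comp, LinearEquiv.range, Submodule.map_top,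
    Submodule.range_subtype]

end Spans

open Classical in
theorem w_eq_sum (n k : ℕ) :
    w F n k = ∑ p : Matrix (Fin n) (Fin n) F × Matrix (Fin n) (Fin n) F ×
      Matrix (Fin n) (Fin n) F × (Fin n → F),
      if Module.finrank F (orbitSpan p.1 p.2.1 p.2.2.1 p.2.2.2) = k then
        zeroSubOne (potential p.1 p.2.1 p.2.2.1) else 0 := by
  simp only [w, Ycard, Zcard, Nat.card_eq_fintype_card, Fintype.card_subtype,
    Finset.card_filter, Nat.cast_sum, ← Finset.sum_sub_distrib]
  refine Finset.sum_congr rfl fun p _ => ?_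
  by_cases h : Module.finrank F (orbitSpan p.1 p.2.1 p.2.2.1 p.2.2.2) = k
  · have h' : Module.finrank F (abcSpan F p.1 p.2.1 p.2.2.1 p.2.2.2) = k := h
    simp only [h, h', zeroSubOne, potential, and_true, if_true, Nat.cast_ite, Nat.cast_one,
      Nat.cast_zero]
    congr!
  · have h' : ¬ Module.finrank F (abcSpan F p.1 p.2.1 p.2.2.1 p.2.2.2) = k := h
    simp [h, h']

theorem w_self (k : ℕ) : w F k k = signedCount (⊤ : Submodule F (Fin k → F)) := by
  rw [w_eq_sum, signedCount]
  refine Finset.sum_congr rfl fun p _ => ?_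
  have h (W : Submodule F (Fin k → F)) : Module.finrank F W = k ↔ W = ⊤ := by
    refine ⟨fun h => Submodule.eq_top_of_finrank_eq (by simpa using h), ?_⟩
    rintro rfl
    simp
  simp only [h]

theorem w_eq_sum_signedCount (n k : ℕ)
    [Fintype {W : Submodule F (Fin n → F) // Module.finrank F W = k}] :
    w F n k = ∑ W : {W : Submodule F (Fin n → F) // Module.finrank F W = k},
      signedCount W.1 := by
  simp only [w_eq_sum, signedCount]
  rw [Finset.sum_comm]
  refine Finset.sum_congr rfl fun p _ => ?_
  split_ifs with h
  · symm
    refine (Fintype.sum_eq_single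
      (⟨_, h⟩ : {W : Submodule F (Fin n → F) // Module.finrank F W = k}) ?_).trans (if_pos rfl)
    exact fun W hW => if_neg fun hW' => hW (Subtype.ext hW'.symm)
  · refine (Finset.sum_eq_zero fun W _ => if_neg ?_).symm
    intro hW
    exact h (by rw [hW, W.2])

/-- `w_n^k = G_q(k,n) · q^{(n−k)(n+2k)} · c_{n−k} · w_k^k`. -/
theorem statement_10 (q : ℕ) (hq : Fintype.card F = q) (n k : ℕ) (hk : k ≤ n) :
    w F n k = (grassCard F k n : ℤ) * (q : ℤ) ^ ((n - k) * (n + 2 * k)) *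
      (ccount F (n - k) : ℤ) * w F k k := by
  subst hq
  have := Fintype.ofFinite {W : Submodule F (Fin n → F) // Module.finrank F W = k}
  have h (W : {W : Submodule F (Fin n → F) // Module.finrank F W = k}) :
      signedCount W.1 = (Fintype.card F : ℤ) ^ ((n - k) * (n + 2 * k)) *
        (ccount F (n - k) : ℤ) * w F k k := by
    obtain ⟨f, hf⟩ := exists_linearEquiv_map_range_extendZero (m := n - k)
      (by simpa using Nat.add_sub_cancel' hk) W.2
    rw [← hf, signedCount_map, signedCount_range_extendZero, w_self, ccount]
    obtain ⟨m, rfl⟩ := Nat.exists_eq_add_of_le hk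
    simp only [Fintype.card_fin, Nat.add_sub_cancel_left]
    ring
  rw [w_eq_sum_signedCount, Finset.sum_congr rfl fun W _ => h W, Finset.sum_const,
    Finset.card_univ, ← Nat.card_eq_fintype_card, nsmul_eq_mul, grassCard]
  ring
end

section
/- Let F be a finite field with q elements and let 0 ≤ k ≤ n. Then q^{n−k} · #Z_n^k = q^{3k(n−k)} · G_q(k,n) · ( #Y_k^k · #Z_{n−k} + (q−2) · #Z_k^k · #Z_{n−k} + #Z_k^k · #Y_{n−k} ), where G_q(k,n) is the number of k-dimensional F-subspaces of Fⁿ. -/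
open Matrix

variable (F : Type*) [Field F] [Fintype F]

/-- `#Y_m`: the number of tuples `(A,B,C,v) ∈ M_m(F)³ × Fᵐ` with `tr(A(BC−CB)) = 0`. -/
noncomputable def YcardAll (m : ℕ) : ℕ :=
  Nat.card {p : Matrix (Fin m) (Fin m) F × Matrix (Fin m) (Fin m) F ×
    Matrix (Fin m) (Fin m) F × (Fin m → F) //
    Matrix.trace (p.1 * (p.2.1 * p.2.2.1 - p.2.2.1 * p.2.1)) = 0}

/-- `#Z_m`: the number of tuples `(A,B,C,v) ∈ M_m(F)³ × Fᵐ` with `tr(A(BC−CB)) = 1`. -/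
noncomputable def ZcardAll (m : ℕ) : ℕ :=
  Nat.card {p : Matrix (Fin m) (Fin m) F × Matrix (Fin m) (Fin m) F ×
    Matrix (Fin m) (Fin m) F × (Fin m → F) //
    Matrix.trace (p.1 * (p.2.1 * p.2.2.1 - p.2.2.1 * p.2.1)) = 1}

/-- The data `(A, B, C, v)` of three square matrices and a vector. -/
abbrev MatrixTriple (K ι : Type*) :=
  Matrix ι ι K × Matrix ι ι K × Matrix ι ι K × (ι → K)

namespace MatrixTriple

section inclLeft

variable {K ι κ : Type*} [Field K]

/-- The linear inclusion of the first block of coordinates. -/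
def inclLeft (K ι κ : Type*) [Field K] : (ι → K) →ₗ[K] (ι ⊕ κ → K) where
  toFun x := Sum.elim x 0
  map_add' x y := by ext (i | i) <;> simp
  map_smul' a x := by ext (i | i) <;> simp

lemma mem_range_inclLeft {x : ι ⊕ κ → K} :
    x ∈ LinearMap.range (inclLeft K ι κ) ↔ ∀ j, x (Sum.inr j) = 0 := by
  constructor
  · rintro ⟨y, rfl⟩ j
    rfl
  · intro h
    refine ⟨fun i => x (Sum.inl i), ?_⟩
    ext (i | i)
    · rfl
    · exact (h i).symm

lemma inclLeft_injective : Function.Injective (inclLeft K ι κ) := by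
  intro x y h
  ext i
  exact congrFun h (Sum.inl i)

lemma exists_linearEquiv_map_eq_range {m n : ℕ} (hm : m ≤ n)
    (W : Submodule K (Fin n → K)) (hW : Module.finrank K W = m) :
    ∃ e : (Fin n → K) ≃ₗ[K] (Fin m ⊕ Fin (n - m) → K),
      Submodule.orderIsoMapComap e W =
        LinearMap.range (inclLeft K (Fin m) (Fin (n - m))) := by
  obtain ⟨U, hU⟩ := W.exists_isCompl
  have hsum := Submodule.finrank_add_eq_of_isCompl hU
  rw [hW, Module.finrank_fin_fun] at hsum
  have e₁ : W ≃ₗ[K] (Fin m → K) := LinearEquiv.ofFinrankEq _ _ (by simp [hW])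
  have e₂ : U ≃ₗ[K] (Fin (n - m) → K) := LinearEquiv.ofFinrankEq _ _ (by simp; omega)
  refine ⟨(Submodule.prodEquivOfIsCompl W U hU).symm.trans ((e₁.prodCongr e₂).trans
    (LinearEquiv.sumArrowLequivProdArrow _ _ K K).symm), ?_⟩
  ext y
  rw [mem_range_inclLeft, Submodule.orderIsoMapComap_apply, Submodule.mem_map_equiv]
  obtain ⟨⟨x, u⟩, rfl⟩ := ((e₁.prodCongr e₂).trans
    (LinearEquiv.sumArrowLequivProdArrow _ _ K K).symm).surjective y
  have : (x : Fin n → K) + u ∈ W ↔ u = 0 := by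
    rw [Submodule.add_mem_iff_right _ x.2]
    refine ⟨fun h => ?_, fun h => by simp [h]⟩
    exact Subtype.ext ((Submodule.disjoint_def.1 hU.disjoint) _ h u.2)
  simp only [LinearEquiv.trans_symm, LinearEquiv.symm_symm, LinearEquiv.prodCongr_symm,
    LinearEquiv.trans_apply, LinearEquiv.prodCongr_apply, LinearEquiv.apply_symm_apply,
    LinearEquiv.symm_apply_apply, Submodule.coe_prodEquivOfIsCompl', this,
    LinearEquiv.sumArrowLequivProdArrow_symm_apply_inr]
  rw [← e₂.map_eq_zero_iff, funext_iff]
  rfl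

/-- The block upper triangular tuple with diagonal blocks `p` and `(A₂, B₂, C₂)`,
off-diagonal blocks `(X, Y, Z)`, and vector supported in the first block. -/
def block (p : MatrixTriple K ι) (r : Matrix κ κ K × Matrix κ κ K × Matrix κ κ K)
    (x : Matrix ι κ K × Matrix ι κ K × Matrix ι κ K) : MatrixTriple K (ι ⊕ κ) :=
  (Matrix.fromBlocks p.1 x.1 0 r.1, Matrix.fromBlocks p.2.1 x.2.1 0 r.2.1,
    Matrix.fromBlocks p.2.2.1 x.2.2 0 r.2.2, inclLeft K ι κ p.2.2.2)

lemma block_injective : Function.Injective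
    fun t : (MatrixTriple K ι × (Matrix κ κ K × Matrix κ κ K × Matrix κ κ K)) ×
        (Matrix ι κ K × Matrix ι κ K × Matrix ι κ K) => block t.1.1 t.1.2 t.2 := by
  rintro ⟨⟨⟨A, B, C, v⟩, D, E, G⟩, X, Y, Z⟩ ⟨⟨⟨A', B', C', v'⟩, D', E', G'⟩, X', Y', Z'⟩ h
  simp only [block, Prod.mk.injEq, Matrix.fromBlocks_inj, inclLeft_injective.eq_iff] at h
  simp only [Prod.mk.injEq]
  tauto

end inclLeft

variable {K ι : Type*} [Field K] [Fintype ι]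

/-- The potential `tr (A (BC - CB))`. -/
def potential (p : MatrixTriple K ι) : K :=
  Matrix.trace (p.1 * (p.2.1 * p.2.2.1 - p.2.2.1 * p.2.1))

/-- The subspaces containing `v` and invariant under `A`, `B` and `C`. -/
def stable (p : MatrixTriple K ι) : Set (Submodule K (ι → K)) :=
  {W | p.2.2.2 ∈ W ∧ (∀ w ∈ W, p.1.mulVec w ∈ W) ∧ (∀ w ∈ W, p.2.1.mulVec w ∈ W) ∧
    (∀ w ∈ W, p.2.2.1.mulVec w ∈ W)}

lemma isLeast_stable_iff {p : MatrixTriple K ι} {W : Submodule K (ι → K)} :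
    IsLeast p.stable W ↔ sInf p.stable = W := by
  have h : IsLeast p.stable (sInf p.stable) := by
    refine ⟨⟨?_, ?_, ?_, ?_⟩, fun U hU => sInf_le hU⟩
    · simp only [Submodule.mem_sInf]
      exact fun U hU => hU.1
    all_goals
      intro w hw
      simp only [Submodule.mem_sInf] at hw ⊢
      intro U hU
    · exact hU.2.1 w (hw U hU)
    · exact hU.2.2.1 w (hw U hU)
    · exact hU.2.2.2 w (hw U hU)
  exact ⟨fun h' => h.unique h', fun h' => h' ▸ h⟩

/-- Multiplying `A` by a nonzero scalar. -/
def scale (a : Kˣ) : MatrixTriple K ι ≃ MatrixTriple K ι :=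
  (MulAction.toPerm a).prodCongr (Equiv.refl _)

lemma potential_scale (a : Kˣ) (p : MatrixTriple K ι) :
    (scale a p).potential = a * p.potential := by
  simp [scale, potential, Units.smul_def]

lemma stable_scale (a : Kˣ) (p : MatrixTriple K ι) : (scale a p).stable = p.stable := by
  ext W
  have h : (∀ w ∈ W, ((a : K) • p.1).mulVec w ∈ W) ↔ ∀ w ∈ W, p.1.mulVec w ∈ W := by
    refine forall₂_congr fun w _ => ?_
    rw [Matrix.smul_mulVec, Submodule.smul_mem_iff _ a.ne_zero]
  simp only [stable, Set.mem_ofPred_eq]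
  exact and_congr_right fun _ => and_congr_left fun _ => h

/-- The number of tuples of potential `a ≠ 0` satisfying a condition on the set of stable
subspaces does not depend on `a`. -/
lemma card_potential_eq (P : Set (Submodule K (ι → K)) → Prop) {a : K} (ha : a ≠ 0) :
    Nat.card {p : MatrixTriple K ι // p.potential = a ∧ P p.stable} =
      Nat.card {p : MatrixTriple K ι // p.potential = 1 ∧ P p.stable} := by
  refine (Nat.card_congr ((scale (Units.mk0 a ha)).subtypeEquiv fun p => ?_)).symm
  rw [potential_scale, stable_scale]
  simp [ha]

/-- Transport of matrices along a linear equivalence of the underlying vector spaces. -/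
noncomputable def conjMatrix {κ : Type*} [Fintype κ] [DecidableEq ι] [DecidableEq κ]
    (e : (ι → K) ≃ₗ[K] (κ → K)) : Matrix ι ι K ≃ₐ[K] Matrix κ κ K :=
  (Matrix.toLinAlgEquiv'.trans (e.conjAlgEquiv K)).trans LinearMap.toMatrixAlgEquiv'

/-- Transport along a linear equivalence of the underlying vector spaces. -/
noncomputable def conj {κ : Type*} [Fintype κ] [DecidableEq ι] [DecidableEq κ]
    (e : (ι → K) ≃ₗ[K] (κ → K)) : MatrixTriple K ι ≃ MatrixTriple K κ :=
  (conjMatrix e).toEquiv.prodCongr ((conjMatrix e).toEquiv.prodCongr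
    ((conjMatrix e).toEquiv.prodCongr e.toEquiv))

section conj

variable {κ : Type*} [Fintype κ] [DecidableEq ι] [DecidableEq κ]
  (e : (ι → K) ≃ₗ[K] (κ → K))

lemma conj_apply (p : MatrixTriple K ι) : conj e p =
    (conjMatrix e p.1, conjMatrix e p.2.1, conjMatrix e p.2.2.1, e p.2.2.2) := rfl

lemma conjMatrix_mulVec (M : Matrix ι ι K) (w : ι → K) :
    (conjMatrix e M).mulVec (e w) = e (M.mulVec w) := by
  change (LinearMap.toMatrix' (e.toLinearMap ∘ₗ Matrix.toLin' M ∘ₗ e.symm.toLinearMap)).mulVec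
    (e w) = _
  rw [LinearMap.toMatrix'_mulVec]
  simp

lemma trace_conjMatrix (M : Matrix ι ι K) : (conjMatrix e M).trace = M.trace := by
  rw [← Matrix.trace_toLin'_eq (conjMatrix e M), ← Matrix.trace_toLin'_eq M,
    ← LinearMap.trace_conj' (Matrix.toLin' M) e]
  congr 1
  exact Matrix.toLin'_toMatrix' (e.conj (Matrix.toLin' M))

lemma potential_conj (p : MatrixTriple K ι) : (conj e p).potential = p.potential := by
  simp only [conj_apply, potential, ← map_mul, ← map_sub, trace_conjMatrix]

lemma map_mem_stable_conj (p : MatrixTriple K ι) (W : Submodule K (ι → K)) :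
    Submodule.orderIsoMapComap e W ∈ (conj e p).stable ↔ W ∈ p.stable := by
  simp only [stable, Set.mem_ofPred_eq, conj_apply, Submodule.orderIsoMapComap_apply,
    Submodule.mem_map, forall_exists_index, and_imp, forall_apply_eq_imp_iff₂, LinearEquiv.coe_coe,
    conjMatrix_mulVec, EmbeddingLike.apply_eq_iff_eq, exists_eq_right]

lemma isLeast_stable_conj (p : MatrixTriple K ι) (W : Submodule K (ι → K)) :
    IsLeast (conj e p).stable (Submodule.orderIsoMapComap e W) ↔ IsLeast p.stable W := by
  refine and_congr (map_mem_stable_conj e p W) ?_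
  simp only [mem_lowerBounds, (Submodule.orderIsoMapComap e).surjective.forall,
    map_mem_stable_conj, OrderIso.le_iff_le]

end conj

section block

variable {κ : Type*} [Fintype κ]

lemma potential_block (p : MatrixTriple K ι) (r : Matrix κ κ K × Matrix κ κ K × Matrix κ κ K)
    (x : Matrix ι κ K × Matrix ι κ K × Matrix ι κ K) :
    (block p r x).potential =
      p.potential + Matrix.trace (r.1 * (r.2.1 * r.2.2 - r.2.2 * r.2.1)) := by
  simp [block, potential, Matrix.fromBlocks_multiply, sub_eq_add_neg, Matrix.fromBlocks_neg,
    Matrix.fromBlocks_add, Matrix.trace]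

lemma fromBlocks_mulVec_inclLeft (A : Matrix ι ι K) (X : Matrix ι κ K) (D : Matrix κ κ K)
    (w : ι → K) : (Matrix.fromBlocks A X 0 D).mulVec (inclLeft K ι κ w) =
      inclLeft K ι κ (A.mulVec w) := by
  ext (i | i) <;> simp [inclLeft, Matrix.fromBlocks_mulVec]

lemma map_mem_stable_block {p : MatrixTriple K ι}
    {r : Matrix κ κ K × Matrix κ κ K × Matrix κ κ K}
    {x : Matrix ι κ K × Matrix ι κ K × Matrix ι κ K} {W : Submodule K (ι → K)} :
    W.map (inclLeft K ι κ) ∈ (block p r x).stable ↔ W ∈ p.stable := by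
  simp only [stable, Set.mem_ofPred_eq, block, Submodule.mem_map, forall_exists_index, and_imp,
    forall_apply_eq_imp_iff₂, fromBlocks_mulVec_inclLeft, inclLeft_injective.eq_iff,
    exists_eq_right]

lemma comap_mem_stable_of_block {p : MatrixTriple K ι}
    {r : Matrix κ κ K × Matrix κ κ K × Matrix κ κ K}
    {x : Matrix ι κ K × Matrix ι κ K × Matrix ι κ K} {W : Submodule K (ι ⊕ κ → K)}
    (h : W ∈ (block p r x).stable) : W.comap (inclLeft K ι κ) ∈ p.stable := by
  obtain ⟨h1, h2, h3, h4⟩ := h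
  refine ⟨h1, fun w hw => ?_, fun w hw => ?_, fun w hw => ?_⟩ <;>
    rw [Submodule.mem_comap] at hw ⊢
  · simpa [block, fromBlocks_mulVec_inclLeft] using h2 _ hw
  · simpa [block, fromBlocks_mulVec_inclLeft] using h3 _ hw
  · simpa [block, fromBlocks_mulVec_inclLeft] using h4 _ hw

lemma isLeast_stable_block {p : MatrixTriple K ι}
    {r : Matrix κ κ K × Matrix κ κ K × Matrix κ κ K}
    {x : Matrix ι κ K × Matrix ι κ K × Matrix ι κ K} :
    IsLeast (block p r x).stable (LinearMap.range (inclLeft K ι κ)) ↔ IsLeast p.stable ⊤ := by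
  rw [← Submodule.map_top]
  refine and_congr map_mem_stable_block ⟨fun h U hU => ?_, fun h U hU => ?_⟩
  · have := h (map_mem_stable_block.2 hU)
    rwa [Submodule.map_le_map_iff_of_injective inclLeft_injective] at this
  · rw [Submodule.map_le_iff_le_comap]
    exact h (comap_mem_stable_of_block hU)

lemma toBlocks₂₁_eq_zero {M : Matrix (ι ⊕ κ) (ι ⊕ κ) K}
    (h : ∀ w ∈ LinearMap.range (inclLeft K ι κ),
      M.mulVec w ∈ LinearMap.range (inclLeft K ι κ)) : M.toBlocks₂₁ = 0 := by
  classical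
  ext j i
  have := mem_range_inclLeft.1 (h _ ⟨Pi.single i 1, rfl⟩) j
  have h' : inclLeft K ι κ (Pi.single i 1) = Pi.single (Sum.inl i) 1 := by
    simp [inclLeft]
  rw [h', Matrix.mulVec_single_one] at this
  exact this

lemma exists_eq_block {p : MatrixTriple K (ι ⊕ κ)}
    (h : LinearMap.range (inclLeft K ι κ) ∈ p.stable) :
    p = block (p.1.toBlocks₁₁, p.2.1.toBlocks₁₁, p.2.2.1.toBlocks₁₁, fun i => p.2.2.2 (Sum.inl i))
      (p.1.toBlocks₂₂, p.2.1.toBlocks₂₂, p.2.2.1.toBlocks₂₂)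
      (p.1.toBlocks₁₂, p.2.1.toBlocks₁₂, p.2.2.1.toBlocks₁₂) := by
  obtain ⟨⟨v, hv⟩, hA, hB, hC⟩ := h
  obtain ⟨A, B, C, _⟩ := p
  dsimp only at hv hA hB hC
  subst hv
  simp only [block]
  rw [← toBlocks₂₁_eq_zero hA, fromBlocks_toBlocks, toBlocks₂₁_eq_zero hA,
    ← toBlocks₂₁_eq_zero hB, fromBlocks_toBlocks, toBlocks₂₁_eq_zero hB,
    ← toBlocks₂₁_eq_zero hC, fromBlocks_toBlocks]
  rfl

lemma card_isLeast_stable_range [Finite K] (a : K) :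
    Nat.card {p : MatrixTriple K (ι ⊕ κ) //
        p.potential = a ∧ IsLeast p.stable (LinearMap.range (inclLeft K ι κ))} *
      Nat.card (κ → K) =
    Nat.card {t : MatrixTriple K ι × MatrixTriple K κ //
      t.1.potential + t.2.potential = a ∧ IsLeast t.1.stable ⊤} *
      Nat.card (Matrix ι κ K) ^ 3 := by
  let f : {t : MatrixTriple K ι × MatrixTriple K κ //
        t.1.potential + t.2.potential = a ∧ IsLeast t.1.stable ⊤} ×
      (Matrix ι κ K × Matrix ι κ K × Matrix ι κ K) →
      {p : MatrixTriple K (ι ⊕ κ) //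
        p.potential = a ∧ IsLeast p.stable (LinearMap.range (inclLeft K ι κ))} × (κ → K) :=
    fun t => (⟨block t.1.1.1 (t.1.1.2.1, t.1.1.2.2.1, t.1.1.2.2.2.1) t.2, by
      rw [potential_block, isLeast_stable_block]
      exact t.1.2⟩, t.1.1.2.2.2.2)
  have hf : Function.Bijective f := by
    constructor
    · rintro ⟨⟨⟨p, A, B, C, v⟩, h⟩, x⟩ ⟨⟨⟨p', A', B', C', v'⟩, h'⟩, x'⟩ heq
      simp only [f, Prod.mk.injEq, Subtype.mk.injEq] at heq
      have := block_injective (a₁ := ((p, A, B, C), x)) (a₂ := ((p', A', B', C'), x')) heq.1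
      simp only [Prod.mk.injEq] at this
      simp only [Prod.mk.injEq, Subtype.mk.injEq]
      tauto
    · rintro ⟨⟨p, hp⟩, v⟩
      have hb := exists_eq_block hp.2.1
      rw [hb, potential_block, isLeast_stable_block] at hp
      exact ⟨(⟨(_, _, _, _, v), hp⟩, _), Prod.ext (Subtype.ext hb.symm) rfl⟩
  rw [← Nat.card_prod, ← Nat.card_congr (Equiv.ofBijective f hf), Nat.card_prod, Nat.card_prod,
    Nat.card_prod]
  ring

lemma card_isLeast_stable [Finite K] {m n : ℕ} (hm : m ≤ n) (a : K)
    (W : Submodule K (Fin n → K)) (hW : Module.finrank K W = m) :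
    Nat.card {p : MatrixTriple K (Fin n) // p.potential = a ∧ IsLeast p.stable W} *
      Nat.card K ^ (n - m) =
    Nat.card {t : MatrixTriple K (Fin m) × MatrixTriple K (Fin (n - m)) //
      t.1.potential + t.2.potential = a ∧ IsLeast t.1.stable ⊤} *
      Nat.card K ^ (3 * m * (n - m)) := by
  obtain ⟨e, he⟩ := exists_linearEquiv_map_eq_range hm W hW
  have h := card_isLeast_stable_range (ι := Fin m) (κ := Fin (n - m)) a
  rw [← Nat.card_congr ((conj e).subtypeEquiv (p := fun p => p.potential = a ∧ IsLeast p.stable W)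
    fun p => by rw [potential_conj, ← he, isLeast_stable_conj])] at h
  have h₁ : Nat.card (Fin (n - m) → K) = Nat.card K ^ (n - m) := by simp [Nat.card_fun]
  have h₂ : Nat.card (Matrix (Fin m) (Fin (n - m)) K) ^ 3 = Nat.card K ^ (3 * m * (n - m)) := by
    rw [Matrix, Nat.card_fun, Nat.card_fun]
    simp only [Nat.card_fin, ← pow_mul]
    ring_nf
  rw [← h₁, ← h₂, h]

end block

/-- Fibering the tuples whose span has dimension `m` over the Grassmannian. -/
lemma card_finrank_span [Finite K] {m n : ℕ} (hm : m ≤ n) (a : K) :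
    Nat.card {p : MatrixTriple K (Fin n) //
        p.potential = a ∧ Module.finrank K ↥(sInf p.stable) = m} * Nat.card K ^ (n - m) =
    Nat.card {W : Submodule K (Fin n → K) // Module.finrank K W = m} *
      (Nat.card {t : MatrixTriple K (Fin m) × MatrixTriple K (Fin (n - m)) //
        t.1.potential + t.2.potential = a ∧ IsLeast t.1.stable ⊤} *
      Nat.card K ^ (3 * m * (n - m))) := by
  let g : {p : MatrixTriple K (Fin n) //
      p.potential = a ∧ Module.finrank K ↥(sInf p.stable) = m} →
      {W : Submodule K (Fin n → K) // Module.finrank K W = m} := fun p => ⟨sInf p.1.stable, p.2.2⟩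
  have := Fintype.ofFinite {W : Submodule K (Fin n → K) // Module.finrank K W = m}
  have hg (W : {W : Submodule K (Fin n → K) // Module.finrank K W = m}) :
      Nat.card {p // g p = W} =
        Nat.card {p : MatrixTriple K (Fin n) // p.potential = a ∧ IsLeast p.stable W.1} := by
    refine Nat.card_congr ((Equiv.subtypeSubtypeEquivSubtypeExists _ _).trans
      (Equiv.subtypeEquivRight fun p => ?_))
    simp only [g, Subtype.ext_iff, isLeast_stable_iff]
    constructor
    · rintro ⟨h, h'⟩
      exact ⟨h.1, h'⟩
    · rintro ⟨h, h'⟩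
      exact ⟨⟨h, h' ▸ W.2⟩, h'⟩
  rw [← Nat.card_congr (Equiv.sigmaFiberEquiv g), Nat.card_sigma, Finset.sum_mul,
    Finset.sum_congr rfl fun W _ => by rw [hg, card_isLeast_stable hm a W.1 W.2], Finset.sum_const,
    smul_eq_mul, Finset.card_univ, Nat.card_eq_fintype_card (α := {W : Submodule K (Fin n → K) // _})]

/-- Distributing the potential `1` over the two diagonal blocks. -/
lemma card_add_potential_eq_one [Finite K] {ι κ : Type*} [Fintype ι] [Fintype κ]
    (P : Set (Submodule K (ι → K)) → Prop) :
    (Nat.card {t : MatrixTriple K ι × MatrixTriple K κ //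
        t.1.potential + t.2.potential = 1 ∧ P t.1.stable} : ℤ) =
      Nat.card {p : MatrixTriple K ι // p.potential = 0 ∧ P p.stable} *
        Nat.card {p : MatrixTriple K κ // p.potential = 1} +
      (Nat.card K - 2) * Nat.card {p : MatrixTriple K ι // p.potential = 1 ∧ P p.stable} *
        Nat.card {p : MatrixTriple K κ // p.potential = 1} +
      Nat.card {p : MatrixTriple K ι // p.potential = 1 ∧ P p.stable} *
        Nat.card {p : MatrixTriple K κ // p.potential = 0} := by
  classical
  have := Fintype.ofFinite K
  let g : {t : MatrixTriple K ι × MatrixTriple K κ //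
    t.1.potential + t.2.potential = 1 ∧ P t.1.stable} → K := fun t => t.1.1.potential
  have hg (a : K) : Nat.card {t // g t = a} =
      Nat.card {p : MatrixTriple K ι // p.potential = a ∧ P p.stable} *
        Nat.card {p : MatrixTriple K κ // p.potential = 1 - a} := by
    rw [← Nat.card_prod]
    refine Nat.card_congr ((Equiv.subtypeSubtypeEquivSubtypeExists _ _).trans
      ((Equiv.subtypeEquivRight fun p => ?_).trans (Equiv.subtypeProdEquivProd)))
    simp only [g, eq_sub_iff_add_eq']
    constructor
    · rintro ⟨h, rfl⟩
      exact ⟨⟨rfl, h.2⟩, h.1⟩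
    · rintro ⟨⟨rfl, h⟩, h'⟩
      exact ⟨⟨h', h⟩, rfl⟩
  have hκ {a : K} (ha : a ≠ 0) : Nat.card {p : MatrixTriple K κ // p.potential = a} =
      Nat.card {p : MatrixTriple K κ // p.potential = 1} := by
    simpa using card_potential_eq (ι := κ) (fun _ => True) ha
  rw [← Nat.card_congr (Equiv.sigmaFiberEquiv g), Nat.card_sigma,
    Finset.sum_congr rfl fun a _ => hg a, ← Finset.add_sum_erase _ _ (Finset.mem_univ 0),
    ← Finset.add_sum_erase _ _ (Finset.mem_erase.2 ⟨one_ne_zero, Finset.mem_univ (1 : K)⟩),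
    Finset.sum_congr rfl (g := fun _ =>
      Nat.card {p : MatrixTriple K ι // p.potential = 1 ∧ P p.stable} *
        Nat.card {p : MatrixTriple K κ // p.potential = 1}) fun a ha => by
      simp only [Finset.mem_erase] at ha
      rw [card_potential_eq P ha.2.1, hκ (sub_ne_zero.2 (Ne.symm ha.1))],
    Finset.sum_const, Finset.card_erase_of_mem (by simp), Finset.card_erase_of_mem (by simp),
    Finset.card_univ, ← Nat.card_eq_fintype_card]
  have h2 : 2 ≤ Nat.card K := Finite.one_lt_card
  simp only [Nat.sub_sub, sub_zero, sub_self, smul_eq_mul]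
  push_cast [h2]
  ring

end MatrixTriple

/-- `q^{n−k} #Z_n^k = q^{3k(n−k)} G_q(k,n) (#Y_k^k · #Z_{n−k} + (q−2) #Z_k^k · #Z_{n−k}
+ #Z_k^k · #Y_{n−k})`. -/
theorem statement_13 (q : ℕ) (hq : Fintype.card F = q) (n k : ℕ) (hk : k ≤ n) :
    (q : ℤ) ^ (n - k) * (Zcard F n k : ℤ) =
      (q : ℤ) ^ (3 * k * (n - k)) * (grassCard F k n : ℤ) *
        ((Ycard F k k : ℤ) * (ZcardAll F (n - k) : ℤ) +
          ((q : ℤ) - 2) * (Zcard F k k : ℤ) * (ZcardAll F (n - k) : ℤ) +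
          (Zcard F k k : ℤ) * (YcardAll F (n - k) : ℤ)) := by
  have h := MatrixTriple.card_finrank_span (K := F) hk 1
  have hY (a : F) : Nat.card {p : MatrixTriple F (Fin k) // p.potential = a ∧ IsLeast p.stable ⊤} =
      Nat.card {p : MatrixTriple F (Fin k) //
        p.potential = a ∧ Module.finrank F ↥(sInf p.stable) = k} := by
    refine Nat.card_congr (Equiv.subtypeEquivRight fun p => and_congr_right fun _ => ?_)
    rw [MatrixTriple.isLeast_stable_iff, Submodule.eq_top_iff_finrank_eq, Module.finrank_fin_fun]
  have h' := MatrixTriple.card_add_potential_eq_one (K := F) (ι := Fin k) (κ := Fin (n - k))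
    (fun S => IsLeast S ⊤)
  rw [hY, hY] at h'
  rw [Nat.card_eq_fintype_card (α := F), hq] at h h'
  have h := congrArg (Nat.cast : ℕ → ℤ) h
  simp only [Nat.cast_mul, Nat.cast_pow] at h
  rw [h'] at h
  change (q : ℤ) ^ (n - k) * (Nat.card {p : MatrixTriple F (Fin n) //
    p.potential = 1 ∧ Module.finrank F ↥(sInf p.stable) = k} : ℤ) = _
  rw [mul_comm, h, mul_comm _ ((q : ℤ) ^ _), mul_left_comm, ← mul_assoc]
  rfl
end

section
/- Let F be a finite field with q elements, let d ≥ 1, let R = F[x₁,…,x_d], and let 𝔪 = (x₁,…,x_d) be the ideal generated by the variables. Then: (i) the number of ideals I of R such that dim_F(R/I) = 2 and 𝔪^N ⊆ I for some N ≥ 0 equals (q^d − 1)/(q − 1); (ii) the number of ideals I of R such that dim_F(R/I) = 3 and 𝔪^N ⊆ I for some N ≥ 0 equals (q^{d+1} − 1)(q^d − 1)/((q² − 1)(q − 1)). -/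
theorem Submodule.card_finrank_eq_mul_prod {K V : Type*} [Field K] [Fintype K] [AddCommGroup V]
    [Module K V] [Finite V] (n : ℕ) :
    Nat.card {U : Submodule K V // Module.finrank K U = n} *
        ∏ i : Fin n, (Fintype.card K ^ n - Fintype.card K ^ i.val) =
      ∏ i : Fin n, (Fintype.card K ^ Module.finrank K V - Fintype.card K ^ i.val) := by
  have : Fintype V := Fintype.ofFinite V
  have : Finite (Submodule K V) := Finite.of_injective _ SetLike.coe_injective
  have : Fintype {U : Submodule K V // Module.finrank K U = n} := Fintype.ofFinite _
  rcases le_or_gt n (Module.finrank K V) with h | h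
  · let e : (Σ U : {U : Submodule K V // Module.finrank K U = n},
        {s : Fin n → U.1 // LinearIndependent K s}) → {s : Fin n → V // LinearIndependent K s} :=
      fun x => ⟨fun i => x.2.1 i, x.2.2.map' x.1.1.subtype x.1.1.ker_subtype⟩
    have span_e (x) : span K (Set.range (e x).1) = x.1.1 := by
      obtain ⟨⟨U, hU⟩, s, hs⟩ := x
      have hr : Set.range (fun i => (s i : V)) = U.subtype '' Set.range s := by
        rw [← Set.range_comp]; rfl
      have : span K (Set.range s) = ⊤ := hs.span_eq_top_of_card_eq_finrank' (by simp [hU])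
      change span K (Set.range fun i => (s i : V)) = U
      rw [hr, span_image, this, map_top, range_subtype]
    have he : Function.Bijective e := by
      constructor
      · intro x y hxy
        have h1 : x.1 = y.1 := Subtype.ext (by rw [← span_e x, ← span_e y, hxy])
        obtain ⟨U, s, hs⟩ := x
        obtain ⟨U', s', hs'⟩ := y
        obtain rfl : U = U' := h1
        obtain rfl : s = s' := funext fun i => Subtype.ext (congrFun (congrArg Subtype.val hxy) i)
        rfl
      · rintro ⟨s, hs⟩
        refine ⟨⟨⟨span K (Set.range s), by simpa using finrank_span_eq_card hs⟩,
          fun i => ⟨s i, subset_span ⟨i, rfl⟩⟩, linearIndependent_span hs⟩, rfl⟩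
    rw [← card_linearIndependent h, ← Nat.card_congr (Equiv.ofBijective e he), Nat.card_sigma,
      Finset.sum_congr rfl fun U _ => ?_, Finset.sum_const, smul_eq_mul, Finset.card_univ,
      Nat.card_eq_fintype_card]
    rw [card_linearIndependent U.2.ge, U.2]
  · have : IsEmpty {U : Submodule K V // Module.finrank K U = n} :=
      ⟨fun U => (h.trans_eq U.2.symm).not_ge (Submodule.finrank_le U.1)⟩
    rw [Nat.card_of_isEmpty, zero_mul, eq_comm]
    exact Finset.prod_eq_zero (Finset.mem_univ ⟨_, h⟩) (Nat.sub_self _)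

theorem Submodule.card_finrank_quotient_eq {K V : Type*} [Field K] [AddCommGroup V]
    [Module K V] [FiniteDimensional K V] (n : ℕ) :
    Nat.card {W : Submodule K V // Module.finrank K (V ⧸ W) = n} =
      Nat.card {U : Submodule K (Module.Dual K V) // Module.finrank K U = n} :=
  Nat.card_congr <| ((Subspace.orderIsoFiniteDimensional (K := K) (V := V)).toEquiv.trans
    OrderDual.ofDual).subtypeEquiv fun W => by
      have h1 := Subspace.finrank_add_finrank_dualAnnihilator_eq W
      have h2 := W.finrank_quotient_add_finrank
      change _ ↔ Module.finrank K W.dualAnnihilator = n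
      omega

theorem Ideal.finrank_quotient_eq_of_surjective {F A M : Type*} [Field F] [CommRing A]
    [Algebra F A] [AddCommGroup M] [Module F M] {J : Ideal A} (L : A →ₗ[F] M)
    (hL : Function.Surjective L) (hJ : ∀ f, f ∈ J ↔ L f = 0) :
    Module.finrank F (A ⧸ J) = Module.finrank F M := by
  have h : J.restrictScalars F = LinearMap.ker L := by ext f; simp [hJ]
  rw [← (Submodule.Quotient.restrictScalarsEquiv F J).finrank_eq,
    (Submodule.quotEquivOfEq _ _ h).finrank_eq, (L.quotKerEquivOfSurjective hL).finrank_eq]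

namespace MvPolynomial

variable {F : Type*} [Field F] {d : ℕ}

theorem coeff_single_one_mul {σ R : Type*} [CommSemiring R] (i : σ) (f g : MvPolynomial σ R) :
    coeff (.single i 1) (f * g) =
      coeff 0 f * coeff (.single i 1) g + coeff (.single i 1) f * coeff 0 g := by
  classical
  rw [coeff_mul, Finsupp.antidiagonal_single, Finset.sum_map,
    Finset.Nat.sum_antidiagonal_succ]
  simp

theorem mem_idealOfVars_iff {σ R : Type*} [CommRing R] (f : MvPolynomial σ R) :
    f ∈ idealOfVars σ R ↔ coeff 0 f = 0 := by
  have h := mem_pow_idealOfVars_iff' (σ := σ) (R := R) 1 f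
  rw [pow_one] at h
  simp [h, Finsupp.degree_eq_zero_iff]

theorem mem_idealOfVars_sq_iff {σ R : Type*} [CommRing R] (f : MvPolynomial σ R) :
    f ∈ idealOfVars σ R ^ 2 ↔ coeff 0 f = 0 ∧ ∀ i, coeff (.single i 1) f = 0 := by
  rw [mem_pow_idealOfVars_iff']
  refine ⟨fun h => ⟨h _ (by simp), fun i => h _ (by simp)⟩, fun h x hx => ?_⟩
  obtain hx | hx : x.degree = 0 ∨ x.degree = 1 := by omega
  · rw [(Finsupp.degree_eq_zero_iff x).1 hx, h.1]
  · obtain ⟨i, rfl⟩ : x ∈ Set.range fun i => Finsupp.single i 1 := by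
      rw [Finsupp.range_single_one]
      exact hx
    exact h.2 i

theorem le_idealOfVars_of_pow_le {σ : Type*} {J : Ideal (MvPolynomial σ F)} (hJ : J ≠ ⊤) {N : ℕ}
    (hN : idealOfVars σ F ^ N ≤ J) : J ≤ idealOfVars σ F := by
  obtain ⟨M, hM, hJM⟩ := J.exists_le_maximal hJ
  have hmax : (idealOfVars σ F).IsMaximal := by
    have : idealOfVars σ F = RingHom.ker (constantCoeff (R := F) (σ := σ)) := by
      ext f; rw [mem_idealOfVars_iff]; rfl
    rw [this]
    exact RingHom.ker_isMaximal_of_surjective _ fun c => ⟨C c, constantCoeff_C _ c⟩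
  exact hJM.trans_eq
    (hmax.eq_of_le hM.ne_top (hM.isPrime.le_of_pow_le (hN.trans hJM))).symm

/-- The linear part of a polynomial, as the vector of its coefficients. -/
noncomputable def linearPart (F : Type*) [Field F] (d : ℕ) :
    MvPolynomial (Fin d) F →ₗ[F] (Fin d → F) :=
  LinearMap.pi fun i => lcoeff F (.single i 1)

theorem linearPart_apply (f : MvPolynomial (Fin d) F) (i : Fin d) :
    linearPart F d f i = coeff (.single i 1) f := rfl

theorem linearPart_mul (f g : MvPolynomial (Fin d) F) :
    linearPart F d (f * g) = coeff 0 f • linearPart F d g + coeff 0 g • linearPart F d f := by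
  ext i
  simp [linearPart_apply, coeff_single_one_mul, mul_comm]

theorem exists_linearPart_eq (c : F) (v : Fin d → F) :
    ∃ f : MvPolynomial (Fin d) F, coeff 0 f = c ∧ linearPart F d f = v := by
  refine ⟨C c + ∑ i, C (v i) * X i, by simp [coeff_sum], ?_⟩
  ext i
  rw [linearPart_apply, coeff_add, coeff_sum, Finset.sum_eq_single i]
  · simp [coeff_C, eq_comm]
  · intro j _ hj
    simp [coeff_X, Finsupp.single_left_inj, hj]
  · simp

/-- The ideal of polynomials without constant term whose linear part lies in a subspace. -/
noncomputable def idealOfLinearPart (W : Submodule F (Fin d → F)) :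
    Ideal (MvPolynomial (Fin d) F) where
  carrier := {f | coeff 0 f = 0 ∧ linearPart F d f ∈ W}
  zero_mem' := by simp
  add_mem' {f g} hf hg := by
    simpa [hf.1, hg.1] using W.add_mem hf.2 hg.2
  smul_mem' r f hf := by
    have hf0 : constantCoeff f = 0 := hf.1
    simpa [linearPart_mul, hf0, ← constantCoeff_eq] using W.smul_mem (coeff 0 r) hf.2

theorem mem_idealOfLinearPart {W : Submodule F (Fin d → F)} {f : MvPolynomial (Fin d) F} :
    f ∈ idealOfLinearPart W ↔ coeff 0 f = 0 ∧ linearPart F d f ∈ W := Iff.rfl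

theorem idealOfVars_sq_le_idealOfLinearPart (W : Submodule F (Fin d → F)) :
    idealOfVars (Fin d) F ^ 2 ≤ idealOfLinearPart W := fun f hf => by
  rw [mem_idealOfVars_sq_iff] at hf
  refine ⟨hf.1, ?_⟩
  rw [show linearPart F d f = 0 from _root_.funext hf.2]
  exact W.zero_mem

theorem finrank_quotient_idealOfLinearPart (W : Submodule F (Fin d → F)) :
    Module.finrank F (MvPolynomial (Fin d) F ⧸ idealOfLinearPart W) =
      Module.finrank F ((Fin d → F) ⧸ W) + 1 := by
  rw [Ideal.finrank_quotient_eq_of_surjective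
    ((W.mkQ ∘ₗ linearPart F d).prod (lcoeff F 0))]
  · simp
  · rintro ⟨w, c⟩
    obtain ⟨v, rfl⟩ := W.mkQ_surjective w
    obtain ⟨f, rfl, rfl⟩ := exists_linearPart_eq c v
    exact ⟨f, rfl⟩
  · intro f
    simp [mem_idealOfLinearPart, and_comm]

theorem idealOfLinearPart_injective :
    Function.Injective (idealOfLinearPart : Submodule F (Fin d → F) → _) := by
  intro W W' h
  ext v
  obtain ⟨f, hf, rfl⟩ := exists_linearPart_eq 0 v
  have := SetLike.ext_iff.1 h f
  simpa [mem_idealOfLinearPart, hf] using this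

theorem exists_idealOfLinearPart_eq {J : Ideal (MvPolynomial (Fin d) F)}
    (h : idealOfVars (Fin d) F ^ 2 ≤ J) (h' : J ≤ idealOfVars (Fin d) F) :
    ∃ W, idealOfLinearPart W = J := by
  refine ⟨(J.restrictScalars F).map (linearPart F d), le_antisymm ?_ fun f hf =>
    ⟨(mem_idealOfVars_iff f).1 (h' hf), f, hf, rfl⟩⟩
  rintro f ⟨hf, g, hg, hfg⟩
  have hg0 := (mem_idealOfVars_iff g).1 (h' hg)
  have : f - g ∈ idealOfVars (Fin d) F ^ 2 := by
    rw [mem_idealOfVars_sq_iff]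
    refine ⟨by simp [hf, hg0], fun i => ?_⟩
    rw [coeff_sub, sub_eq_zero]
    exact (congrFun hfg i).symm
  simpa using J.add_mem (h this) hg

/-- Subspaces of codimension `n` correspond to the ideals of colength `n + 1` lying between
the square of the ideal of the variables and that ideal. -/
noncomputable def idealOfLinearPartEquiv (F : Type*) [Field F] (d n : ℕ) :
    {W : Submodule F (Fin d → F) // Module.finrank F ((Fin d → F) ⧸ W) = n} ≃
    {J : Ideal (MvPolynomial (Fin d) F) //
      (Module.finrank F (MvPolynomial (Fin d) F ⧸ J) = n + 1 ∧
        ∃ N : ℕ, idealOfVars (Fin d) F ^ N ≤ J) ∧ idealOfVars (Fin d) F ^ 2 ≤ J} := by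
  refine Equiv.ofBijective (fun W => ⟨idealOfLinearPart W.1,
    ⟨by rw [finrank_quotient_idealOfLinearPart, W.2],
      2, idealOfVars_sq_le_idealOfLinearPart _⟩, idealOfVars_sq_le_idealOfLinearPart _⟩)
    ⟨fun W W' h => Subtype.ext (idealOfLinearPart_injective (congrArg Subtype.val h)), ?_⟩
  rintro ⟨J, ⟨hn, N, hN⟩, h2⟩
  have hJ : J ≠ ⊤ := by
    rintro rfl
    have := Module.finrank_zero_of_subsingleton (R := F)
      (M := MvPolynomial (Fin d) F ⧸ (⊤ : Ideal (MvPolynomial (Fin d) F)))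
    omega
  obtain ⟨W, rfl⟩ := exists_idealOfLinearPart_eq h2 (le_idealOfVars_of_pow_le hJ hN)
  rw [finrank_quotient_idealOfLinearPart] at hn
  exact ⟨⟨W, by omega⟩, rfl⟩

theorem card_ideal_sq_le_mul_prod [Fintype F] (n : ℕ) :
    Nat.card {J : Ideal (MvPolynomial (Fin d) F) //
      (Module.finrank F (MvPolynomial (Fin d) F ⧸ J) = n + 1 ∧
        ∃ N : ℕ, idealOfVars (Fin d) F ^ N ≤ J) ∧ idealOfVars (Fin d) F ^ 2 ≤ J} *
      ∏ i : Fin n, (Fintype.card F ^ n - Fintype.card F ^ i.val) =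
    ∏ i : Fin n, (Fintype.card F ^ d - Fintype.card F ^ i.val) := by
  have : Finite (Module.Dual F (Fin d → F)) := Module.finite_of_finite F
  rw [← Nat.card_congr (idealOfLinearPartEquiv F d n), Submodule.card_finrank_quotient_eq,
    Submodule.card_finrank_eq_mul_prod, Subspace.dual_finrank_eq, Module.finrank_fin_fun]

end MvPolynomial

open Polynomial in
theorem IsNilpotent.minpoly_eq_X_pow_nilpotencyClass {F A : Type*} [Field F] [Ring A] [Algebra F A]
    {t : A} (ht : IsNilpotent t) : minpoly F t = X ^ nilpotencyClass t := by
  have hdvd : minpoly F t ∣ X ^ nilpotencyClass t :=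
    minpoly.dvd F t (by simpa using pow_nilpotencyClass ht)
  have hint : IsIntegral F t := ⟨X ^ nilpotencyClass t, monic_X_pow _, by
    simpa using pow_nilpotencyClass ht⟩
  obtain ⟨k, hk, h⟩ := (dvd_prime_pow prime_X _).1 hdvd
  have h' := eq_of_monic_of_associated (minpoly.monic hint) (monic_X_pow k) h
  have hk' : t ^ k = 0 := by simpa [h'] using minpoly.aeval F t
  rw [h', hk.antisymm (Nat.sInf_le hk')]

theorem IsNilpotent.nilpotencyClass_le_finrank (F : Type*) {A : Type*} [Field F] [Ring A]
    [Algebra F A] [FiniteDimensional F A] {t : A} (ht : IsNilpotent t) :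
    nilpotencyClass t ≤ Module.finrank F A := by
  simpa [ht.minpoly_eq_X_pow_nilpotencyClass] using minpoly.natDegree_le (A := F) t

theorem mul_eq_zero_of_sq_eq_zero_of_finrank_lt {F A : Type*} [Field F] [CommRing A] [Algebra F A]
    [FiniteDimensional F A] (hA : Module.finrank F A < 4) {x y : A} (hx : x ^ 2 = 0)
    (hy : y ^ 2 = 0) : x * y = 0 := by
  by_contra hxy
  have hli : LinearIndependent F ![1, x, y, x * y] := by
    rw [Fintype.linearIndependent_iff]
    intro g hg
    simp only [Fin.sum_univ_four, Algebra.smul_def, Matrix.cons_val] at hg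
    have cancel (c : F) (hc : algebraMap F A c * (x * y) = 0) : c = 0 := by
      rw [← Algebra.smul_def] at hc
      exact (smul_eq_zero.1 hc).resolve_right hxy
    have h0 : g 0 = 0 := cancel _ (by grind)
    have h1 : g 1 = 0 := cancel _ (by rw [h0, map_zero] at hg; grind)
    have h2 : g 2 = 0 := cancel _ (by rw [h0, map_zero] at hg; grind)
    have h3 : g 3 = 0 := cancel _ (by simpa [h0, h1, h2] using hg)
    intro i
    fin_cases i <;> assumption
  have := hli.fintype_card_le_finrank
  simp at this
  omega

namespace MvPolynomial

variable {F : Type*} [Field F] {d : ℕ}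

theorem isNilpotent_mk_X {J : Ideal (MvPolynomial (Fin d) F)} {N : ℕ}
    (hN : idealOfVars (Fin d) F ^ N ≤ J) (i : Fin d) :
    IsNilpotent (Ideal.Quotient.mk J (X i)) :=
  ⟨N, by
    rw [← map_pow, Ideal.Quotient.eq_zero_iff_mem]
    exact hN (Ideal.pow_mem_pow (Ideal.subset_span (Set.mem_range_self i)) N)⟩

theorem idealOfVars_sq_le_of_X_sq_mem {J : Ideal (MvPolynomial (Fin d) F)}
    [FiniteDimensional F (MvPolynomial (Fin d) F ⧸ J)]
    (hJ : Module.finrank F (MvPolynomial (Fin d) F ⧸ J) < 4) (h : ∀ i, X i ^ 2 ∈ J) :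
    idealOfVars (Fin d) F ^ 2 ≤ J := by
  rw [pow_two, idealOfVars, Ideal.span_mul_span', Ideal.span_le]
  intro _ hf
  obtain ⟨_, ⟨i, rfl⟩, _, ⟨j, rfl⟩, rfl⟩ := hf
  have hsq (i) : Ideal.Quotient.mk J (X i) ^ 2 = 0 := by
    rw [← map_pow, Ideal.Quotient.eq_zero_iff_mem]; exact h i
  simpa [← map_mul, Ideal.Quotient.eq_zero_iff_mem] using
    mul_eq_zero_of_sq_eq_zero_of_finrank_lt hJ (hsq i) (hsq j)

theorem idealOfVars_sq_le_of_finrank_eq_two {J : Ideal (MvPolynomial (Fin d) F)}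
    (hJ : Module.finrank F (MvPolynomial (Fin d) F ⧸ J) = 2) {N : ℕ}
    (hN : idealOfVars (Fin d) F ^ N ≤ J) : idealOfVars (Fin d) F ^ 2 ≤ J := by
  have : FiniteDimensional F (MvPolynomial (Fin d) F ⧸ J) :=
    Module.finite_of_finrank_pos (by omega)
  refine idealOfVars_sq_le_of_X_sq_mem (by omega) fun i => ?_
  have ht := isNilpotent_mk_X hN i
  rw [← Ideal.Quotient.eq_zero_iff_mem, map_pow]
  exact pow_eq_zero_of_le ((ht.nilpotencyClass_le_finrank F).trans_eq hJ) (pow_nilpotencyClass ht)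

/-- Substitution of the `2`-jet of a curve `t ↦ a t + b t²` through the origin. -/
noncomputable def jetHom (a b : Fin d → F) : MvPolynomial (Fin d) F →ₐ[F] Polynomial F :=
  aeval fun j => .C (a j) * .X + .C (b j) * .X ^ 2

/-- The ideal of polynomials vanishing to order `3` along the curve `t ↦ a t + b t²`. -/
noncomputable def jetIdeal (a b : Fin d → F) : Ideal (MvPolynomial (Fin d) F) :=
  (Ideal.span {Polynomial.X ^ 3}).comap (jetHom a b)

theorem jetHom_X (a b : Fin d → F) (j : Fin d) :
    jetHom a b (X j) = .C (a j) * .X + .C (b j) * .X ^ 2 := aeval_X ..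

theorem jetHom_C (a b : Fin d → F) (c : F) : jetHom a b (C c) = .C c := algHom_C ..

theorem mem_jetIdeal {a b : Fin d → F} {f : MvPolynomial (Fin d) F} :
    f ∈ jetIdeal a b ↔ Polynomial.X ^ 3 ∣ jetHom a b f := by
  rw [jetIdeal, Ideal.mem_comap, Ideal.mem_span_singleton]

theorem mem_jetIdeal_iff_coeff {a b : Fin d → F} {f : MvPolynomial (Fin d) F} :
    f ∈ jetIdeal a b ↔ ∀ k < 3, (jetHom a b f).coeff k = 0 := by
  rw [mem_jetIdeal, Polynomial.X_pow_dvd_iff]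

theorem idealOfVars_pow_three_le_jetIdeal (a b : Fin d → F) :
    idealOfVars (Fin d) F ^ 3 ≤ jetIdeal a b := by
  have h : idealOfVars (Fin d) F ≤ (Ideal.span {Polynomial.X}).comap (jetHom a b) := by
    rw [idealOfVars, Ideal.span_le]
    rintro _ ⟨j, rfl⟩
    rw [SetLike.mem_coe, Ideal.mem_comap, Ideal.mem_span_singleton, jetHom_X]
    exact ⟨.C (a j) + .C (b j) * .X, by ring⟩
  refine (Ideal.pow_right_mono h 3).trans ((Ideal.le_comap_pow _ 3).trans ?_)
  rw [Ideal.span_singleton_pow]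
  rfl

theorem X_sq_mem_jetIdeal_iff {a b : Fin d → F} {i : Fin d} :
    X i ^ 2 ∈ jetIdeal a b ↔ a i = 0 := by
  have h : jetHom a b (X i ^ 2) = .C (a i ^ 2) * .X ^ 2 +
      .X ^ 3 * (.C (2 * a i * b i) + .C (b i ^ 2) * .X) := by
    rw [map_pow, jetHom_X]
    simp only [map_pow, map_mul, map_ofNat]
    ring
  rw [mem_jetIdeal, h, dvd_add_left (dvd_mul_right _ _), Polynomial.X_pow_dvd_iff]
  constructor
  · intro h
    have h2 := h 2 (by norm_num)
    rw [Polynomial.coeff_C_mul_X_pow] at h2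
    simpa using h2
  · intro h
    simp [h]

theorem jetHom_C_add_C_mul_X_add_C_mul_X_sq {a b : Fin d → F} {i : Fin d} (ha : a i = 1)
    (hb : b i = 0) (c₀ c₁ c₂ : F) :
    jetHom a b (C c₀ + C c₁ * X i + C c₂ * X i ^ 2) =
      .C c₀ + .C c₁ * .X + .C c₂ * .X ^ 2 := by
  simp [jetHom_X, ha, hb]

theorem finrank_quotient_jetIdeal {a b : Fin d → F} {i : Fin d} (ha : a i = 1) (hb : b i = 0) :
    Module.finrank F (MvPolynomial (Fin d) F ⧸ jetIdeal a b) = 3 := by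
  rw [Ideal.finrank_quotient_eq_of_surjective
    (LinearMap.pi fun k : Fin 3 => Polynomial.lcoeff F k ∘ₗ (jetHom a b).toLinearMap)]
  · simp
  · intro v
    refine ⟨C (v 0) + C (v 1) * X i + C (v 2) * X i ^ 2, ?_⟩
    ext k
    simp only [LinearMap.pi_apply, LinearMap.comp_apply, AlgHom.toLinearMap_apply,
      jetHom_C_add_C_mul_X_add_C_mul_X_sq ha hb, Polynomial.lcoeff_apply]
    fin_cases k <;> simp [Polynomial.coeff_X, Polynomial.coeff_C, Polynomial.coeff_X_pow]
  · intro f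
    rw [mem_jetIdeal_iff_coeff, _root_.funext_iff, Fin.forall_iff]
    rfl

theorem eq_of_jetIdeal_eq {a b a' b' : Fin d → F} {i : Fin d} (ha : a i = 1) (hb : b i = 0)
    (ha' : a' i = 1) (hb' : b' i = 0) (h : jetIdeal a b = jetIdeal a' b') :
    a = a' ∧ b = b' := by
  have hmem (j : Fin d) : X j - (C 0 + C (a j) * X i + C (b j) * X i ^ 2) ∈ jetIdeal a b := by
    rw [mem_jetIdeal, map_sub, jetHom_C_add_C_mul_X_add_C_mul_X_sq ha hb, jetHom_X]
    simp
  simp only [h, mem_jetIdeal_iff_coeff, map_sub, jetHom_C_add_C_mul_X_add_C_mul_X_sq ha' hb',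
    jetHom_X] at hmem
  constructor <;> ext j
  · simpa [Polynomial.coeff_X, sub_eq_zero, eq_comm] using hmem j 1 (by norm_num)
  · simpa [Polynomial.coeff_X, sub_eq_zero, eq_comm] using hmem j 2 (by norm_num)

theorem exists_jetIdeal_eq {J : Ideal (MvPolynomial (Fin d) F)}
    (hJ : Module.finrank F (MvPolynomial (Fin d) F ⧸ J) = 3) {N : ℕ}
    (hN : idealOfVars (Fin d) F ^ N ≤ J) {i : Fin d} (hi : X i ^ 2 ∉ J) :
    ∃ a b, a i = 1 ∧ b i = 0 ∧ jetIdeal a b = J := by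
  have : FiniteDimensional F (MvPolynomial (Fin d) F ⧸ J) :=
    Module.finite_of_finrank_pos (by omega)
  have hJm : J ≤ idealOfVars (Fin d) F := by
    refine le_idealOfVars_of_pow_le ?_ hN
    rintro rfl
    simp at hi
  set t := Ideal.Quotient.mk J (X i) with ht_def
  have ht : IsNilpotent t := isNilpotent_mk_X hN i
  have hclass : nilpotencyClass t = 3 := by
    refine le_antisymm ((ht.nilpotencyClass_le_finrank F).trans_eq hJ) (not_lt.1 fun h => hi ?_)
    rw [← Ideal.Quotient.eq_zero_iff_mem, map_pow]
    exact pow_eq_zero_of_le (Nat.le_of_lt_succ h) (pow_nilpotencyClass ht)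
  have hmin : minpoly F t = Polynomial.X ^ 3 := by
    rw [ht.minpoly_eq_X_pow_nilpotencyClass, hclass]
  have hspan : Submodule.span F (Set.range fun k : Fin (minpoly F t).natDegree => t ^ k.val) = ⊤ :=
    (linearIndependent_pow t).span_eq_top_of_card_eq_finrank' (by simp [hmin, hJ])
  have smul_eq (c : F) (x : MvPolynomial (Fin d) F ⧸ J) : c • x = algebraMap F _ c * x :=
    Algebra.smul_def c x
  have hX (j : Fin d) : ∃ α β : F,
      Ideal.Quotient.mk J (X j) = algebraMap F _ α * t + algebraMap F _ β * t ^ 2 := by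
    have hj : Ideal.Quotient.mk J (X j) ∈
      Submodule.span F (Set.range fun k : Fin (minpoly F t).natDegree => t ^ k.val) :=
      hspan ▸ Submodule.mem_top
    rw [hmin, Polynomial.natDegree_X_pow, Submodule.mem_span_range_iff_exists_fun] at hj
    obtain ⟨c, hc⟩ := hj
    refine ⟨c 1, c 2, ?_⟩
    have hmem : C (c 0) + C (c 1) * X i + C (c 2) * X i ^ 2 - X j ∈ J := by
      rw [← Ideal.Quotient.eq_zero_iff_mem, map_sub, sub_eq_zero, ← hc]
      simp [Fin.sum_univ_three, smul_eq, ht_def]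
      rfl
    have hc0 : c 0 = 0 := by
      simpa [← constantCoeff_eq] using (mem_idealOfVars_iff _).1 (hJm hmem)
    simp [← hc, Fin.sum_univ_three, hc0, smul_eq]
  have hX' (j : Fin d) : ∃ α β : F,
      Ideal.Quotient.mk J (X j) = algebraMap F _ α * t + algebraMap F _ β * t ^ 2 ∧
      (j = i → α = 1 ∧ β = 0) := by
    by_cases hj : j = i
    · exact ⟨1, 0, by simp [hj, ht_def], fun _ => ⟨rfl, rfl⟩⟩
    · obtain ⟨α, β, h⟩ := hX j
      exact ⟨α, β, h, fun h => absurd h hj⟩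
  choose a b hab hi' using hX'
  refine ⟨a, b, (hi' i rfl).1, (hi' i rfl).2, ?_⟩
  have hcomp : (Polynomial.aeval t).comp (jetHom a b) = Ideal.Quotient.mkₐ F J := by
    ext j
    simp [jetHom_X, hab]
  ext f
  rw [mem_jetIdeal, ← hmin, minpoly.dvd_iff, ← AlgHom.comp_apply, hcomp,
    Ideal.Quotient.mkₐ_eq_mk, Ideal.Quotient.eq_zero_iff_mem]

/-- Parameters of the curvilinear ideals for which `X i` is the first variable whose square does
not lie in the ideal. -/
abbrev NormalizedJet (F : Type*) [Field F] {d : ℕ} (i : Fin d) : Type _ :=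
  {a : Fin d → F // a i = 1 ∧ ∀ j < i, a j = 0} × {b : Fin d → F // b i = 0}

theorem card_normalizedJet {F : Type*} [Field F] [Fintype F] {d : ℕ} (i : Fin d) :
    Nat.card (NormalizedJet F i) =
      Fintype.card F ^ (d - 1 - i) * Fintype.card F ^ (d - 1) := by
  classical
  rw [Nat.card_prod]
  congr 1
  · have e : {a : Fin d → F // a i = 1 ∧ ∀ j < i, a j = 0} ≃ (Finset.Ioi i → F) :=
      { toFun a j := a.1 j
        invFun v := ⟨fun j => if h : i < j then v ⟨j, Finset.mem_Ioi.2 h⟩ else if j = i then 1 else 0,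
          by simp, fun j hj => by simp [hj.not_gt, hj.ne]⟩
        left_inv := by
          rintro ⟨a, hi, ha⟩
          ext j
          rcases lt_trichotomy i j with h | rfl | h
          · simp [h]
          · simp [hi]
          · simp [h.not_gt, h.ne, ha j h]
        right_inv v := by
          ext ⟨j, hj⟩
          simp [Finset.mem_Ioi.1 hj] }
    rw [Nat.card_congr e, Nat.card_fun]
    simp only [Nat.card_eq_fintype_card, Fintype.card_coe, Fin.card_Ioi]
  · have e : {b : Fin d → F // b i = 0} ≃ ({j // j ≠ i} → F) :=
      { toFun b j := b.1 j
        invFun v := ⟨fun j => if h : j = i then 0 else v ⟨j, h⟩, by simp⟩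
        left_inv := by
          rintro ⟨b, hb⟩
          ext j
          by_cases h : j = i
          · simp [h, hb]
          · simp [h]
        right_inv v := by
          ext ⟨j, hj⟩
          simp [hj] }
    rw [Nat.card_congr e]
    simp

theorem card_curvilinear_ideal [Fintype F] :
    Nat.card {J : Ideal (MvPolynomial (Fin d) F) //
      (Module.finrank F (MvPolynomial (Fin d) F ⧸ J) = 3 ∧
        ∃ N : ℕ, idealOfVars (Fin d) F ^ N ≤ J) ∧ ¬ idealOfVars (Fin d) F ^ 2 ≤ J} =
    (∑ i ∈ Finset.range d, Fintype.card F ^ i) * Fintype.card F ^ (d - 1) := by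
  have hsq {J : Ideal (MvPolynomial (Fin d) F)} {i : Fin d} (hi : X i ^ 2 ∉ J) :
      ¬ idealOfVars (Fin d) F ^ 2 ≤ J :=
    fun h => hi (h (Ideal.pow_mem_pow (Ideal.subset_span (Set.mem_range_self i)) 2))
  let e (x : Σ i : Fin d, NormalizedJet F i) : {J : Ideal (MvPolynomial (Fin d) F) //
      (Module.finrank F (MvPolynomial (Fin d) F ⧸ J) = 3 ∧
        ∃ N : ℕ, idealOfVars (Fin d) F ^ N ≤ J) ∧ ¬ idealOfVars (Fin d) F ^ 2 ≤ J} :=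
    ⟨jetIdeal x.2.1.1 x.2.2.1, ⟨finrank_quotient_jetIdeal x.2.1.2.1 x.2.2.2,
      3, idealOfVars_pow_three_le_jetIdeal _ _⟩,
      hsq (i := x.1) (by simp [X_sq_mem_jetIdeal_iff, x.2.1.2.1])⟩
  have he : Function.Bijective e := by
    constructor
    · rintro ⟨i, ⟨a, ha, ha0⟩, b, hb⟩ ⟨i', ⟨a', ha', ha0'⟩, b', hb'⟩ h
      have hJ : jetIdeal a b = jetIdeal a' b' := congrArg Subtype.val h
      have hiff (j : Fin d) : a j = 0 ↔ a' j = 0 := by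
        rw [← X_sq_mem_jetIdeal_iff (b := b), hJ, X_sq_mem_jetIdeal_iff]
      obtain rfl : i = i' := by
        rcases lt_trichotomy i i' with hlt | heq | hlt
        · exact absurd ((hiff i).2 (ha0' i hlt)) (by simp [ha])
        · exact heq
        · exact absurd ((hiff i').1 (ha0 i' hlt)) (by simp [ha'])
      obtain ⟨rfl, rfl⟩ := eq_of_jetIdeal_eq ha hb ha' hb' hJ
      rfl
    · rintro ⟨J, ⟨hJ, N, hN⟩, hJ2⟩
      have : FiniteDimensional F (MvPolynomial (Fin d) F ⧸ J) :=
        Module.finite_of_finrank_pos (by omega)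
      have hex : ∃ i, X i ^ 2 ∉ J := by
        by_contra! h
        exact hJ2 (idealOfVars_sq_le_of_X_sq_mem (by omega) h)
      obtain ⟨i, hi, hmin⟩ := WellFounded.has_min (wellFounded_lt (α := Fin d)) {i | X i ^ 2 ∉ J} hex
      obtain ⟨a, b, ha, hb, rfl⟩ := exists_jetIdeal_eq hJ hN hi
      refine ⟨⟨i, ⟨a, ha, fun j hj => ?_⟩, b, hb⟩, rfl⟩
      rw [← X_sq_mem_jetIdeal_iff (b := b)]
      exact not_not.1 fun h => hmin j h hj
  rw [← Nat.card_congr (Equiv.ofBijective e he), Nat.card_sigma]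
  simp_rw [card_normalizedJet]
  rw [← Finset.sum_mul, Fin.sum_univ_eq_sum_range (fun i => Fintype.card F ^ (d - 1 - i)) d,
    Finset.sum_range_reflect (fun i => Fintype.card F ^ i) d]

end MvPolynomial

theorem Nat.card_subtype_eq_card_and_add_card_and_not {α : Type*} (P Q : α → Prop)
    [Finite {x // P x ∧ Q x}] [Finite {x // P x ∧ ¬ Q x}] :
    Nat.card {x // P x} = Nat.card {x // P x ∧ Q x} + Nat.card {x // P x ∧ ¬ Q x} := by
  classical
  rw [← Nat.card_sum]
  exact Nat.card_congr ((Equiv.sumCompl fun x : {x // P x} => Q x).symm.trans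
    (Equiv.sumCongr (Equiv.subtypeSubtypeEquivSubtypeInter P Q)
      (Equiv.subtypeSubtypeEquivSubtypeInter P fun x => ¬ Q x)))

/-- Over a finite field `F` with `q` elements, with `R = F[x₁,…,x_d]` and
`𝔪 = (x₁,…,x_d)`, the number of ideals `I ⊆ R` with `dim_F R/I = 2` and `𝔪^N ⊆ I` for
some `N` equals `(q^d − 1)/(q − 1)`, and the number with `dim_F R/I = 3` equals
`(q^{d+1} − 1)(q^d − 1)/((q² − 1)(q − 1))`. -/
theorem statement_16 (F : Type*) [Field F] [Fintype F] (q : ℕ)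
    (hq : Fintype.card F = q) (d : ℕ) (hd : 1 ≤ d) :
    ((Nat.card {I : Ideal (MvPolynomial (Fin d) F) //
        Module.finrank F (MvPolynomial (Fin d) F ⧸ I) = 2 ∧
        ∃ N : ℕ, (Ideal.span (Set.range (MvPolynomial.X : Fin d → MvPolynomial (Fin d) F))) ^ N ≤ I} : ℚ) =
      ((q : ℚ) ^ d - 1) / ((q : ℚ) - 1)) ∧
    ((Nat.card {I : Ideal (MvPolynomial (Fin d) F) //
        Module.finrank F (MvPolynomial (Fin d) F ⧸ I) = 3 ∧
        ∃ N : ℕ, (Ideal.span (Set.range (MvPolynomial.X : Fin d → MvPolynomial (Fin d) F))) ^ N ≤ I} : ℚ) =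
      ((q : ℚ) ^ (d + 1) - 1) * ((q : ℚ) ^ d - 1) /
        (((q : ℚ) ^ 2 - 1) * ((q : ℚ) - 1))) := by
  subst hq
  have hq : 1 < Fintype.card F := Fintype.one_lt_card
  have h₁ := MvPolynomial.card_ideal_sq_le_mul_prod (F := F) (d := d) 1
  have h₂ := MvPolynomial.card_ideal_sq_le_mul_prod (F := F) (d := d) 2
  have h₃ := MvPolynomial.card_curvilinear_ideal (F := F) (d := d)
  have : Finite (Submodule F (Fin d → F)) := Finite.of_injective _ SetLike.coe_injective
  have := Finite.of_equiv _ (MvPolynomial.idealOfLinearPartEquiv F d 2)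
  have := Nat.finite_of_card_ne_zero (h₃.trans_ne
    (mul_ne_zero (Finset.sum_pos (fun _ _ => by positivity) ⟨0, by simp; omega⟩).ne'
      (by positivity)))
  have e₂ := Nat.card_congr (Equiv.subtypeEquivRight fun J : Ideal (MvPolynomial (Fin d) F) =>
    (and_iff_left_of_imp fun hJ : Module.finrank F (MvPolynomial (Fin d) F ⧸ J) = 2 ∧
      ∃ N : ℕ, MvPolynomial.idealOfVars (Fin d) F ^ N ≤ J =>
        MvPolynomial.idealOfVars_sq_le_of_finrank_eq_two hJ.1 hJ.2.choose_spec).symm)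
  have e₃ := Nat.card_subtype_eq_card_and_add_card_and_not
    (fun J : Ideal (MvPolynomial (Fin d) F) =>
      Module.finrank F (MvPolynomial (Fin d) F ⧸ J) = 3 ∧
        ∃ N : ℕ, MvPolynomial.idealOfVars (Fin d) F ^ N ≤ J)
    (fun J => MvPolynomial.idealOfVars (Fin d) F ^ 2 ≤ J)
  rw [h₃] at e₃
  rw [← e₂] at h₁
  generalize Fintype.card F = q at *
  have hqd : q ≤ q ^ d := Nat.le_self_pow (by omega) q
  have hq2 : q ≤ q ^ 2 := Nat.le_self_pow (by omega) q
  have hqQ : (1 : ℚ) < q := by exact_mod_cast hq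
  have hq₁ : (q : ℚ) - 1 ≠ 0 := by linarith
  have hq₂ : (q : ℚ) ^ 2 - 1 ≠ 0 := by nlinarith
  simp only [Fin.prod_univ_one, Fin.prod_univ_two, Fin.val_zero, Fin.val_one, pow_zero, pow_one]
    at h₁ h₂
  apply_fun ((↑) : ℕ → ℚ) at h₁ h₂
  push_cast [Nat.cast_sub, hq.le, hqd, hq2, hq.le.trans hqd, hq.le.trans hq2] at h₁ h₂
  constructor
  · rwa [eq_div_iff hq₁]
  · rw [e₃]
    push_cast
    rw [geom_sum_eq hqQ.ne']
    obtain ⟨k, rfl⟩ : ∃ k, d = k + 1 := ⟨d - 1, by omega⟩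
    rw [← eq_div_iff (mul_ne_zero hq₂ (by nlinarith))] at h₂
    rw [h₂, Nat.add_sub_cancel, show (q : ℚ) ^ 2 - q = q * (q - 1) by ring]
    field_simp
    ring
end
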